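/- There exist absolute constants ρ₁ > ρ₂ > 0 — and one may take any ρ₁ > 8 and any ρ₂ < 2/π — such that along any sequence of pairs (n,d) with n, d → ∞: (i) if d² ≥ ρ₁ n log n for all terms of the sequence, then P(PR_n) → 1; and (ii) if d² ≤ ρ₂ n log n for all terms of the sequence, then P(PR_n) → 0. -/

import Mathlib

open MeasureTheory ProbabilityTheory Filter Topology Matrix

noncomputable section

/-- The law `N(0, I_d/d)` on `ℝ^d`, realized as a product of `d` one-dimensional
centered Gaussians of variance `1/d`. -/
def stdGaussianVec (d : ℕ) : Measure (Fin d → ℝ) :=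
  Measure.pi fun _ => gaussianReal 0 (d : NNReal)⁻¹

/-- The Gaussian model: `u_1, …, u_n, v_1, …, v_n` mutually independent `N(0, I_d/d)`
random vectors, packaged as a probability measure on pairs `(U, V)` of `n`-tuples. -/
def gaussianModel (d n : ℕ) :
    Measure ((Fin n → Fin d → ℝ) × (Fin n → Fin d → ℝ)) :=
  (Measure.pi fun _ : Fin n => stdGaussianVec d).prod
    (Measure.pi fun _ : Fin n => stdGaussianVec d)

/-- The score `s_{j,i}(W) = u_j^⊤ W v_i`. -/
def score {d n : ℕ} (u v : Fin n → Fin d → ℝ) (W : Matrix (Fin d) (Fin d) ℝ)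
    (j i : Fin n) : ℝ :=
  u j ⬝ᵥ W.mulVec (v i)

/-- The top-1 retrieval event `PR_n`: there exists some memory matrix `W` such that
`u_i^⊤ W v_i > u_j^⊤ W v_i` for all `i` and all `j ≠ i`. -/
def PRset (d n : ℕ) : Set ((Fin n → Fin d → ℝ) × (Fin n → Fin d → ℝ)) :=
  {p | ∃ W : Matrix (Fin d) (Fin d) ℝ,
    ∀ i j : Fin n, j ≠ i → score p.1 p.2 W j i < score p.1 p.2 W i i}


open Finset in
lemma lintegral_pi_prod_le {ι E : Type*} [Fintype ι] [DecidableEq ι] [MeasurableSpace E]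
    (μ : ι → Measure E) [∀ i, IsProbabilityMeasure (μ i)] (s : Finset ι)
    (F : ι → (ι → E) → E → ENNReal) (hF : ∀ k, Measurable fun x => F k x (x k))
    (hF2 : ∀ k x, Measurable (F k x))
    (c : ι → ENNReal)
    (hinv : ∀ k ∈ s, ∀ i ∈ s, ∀ x y, F k (Function.update x i y) = F k x)
    (hc : ∀ k ∈ s, ∀ x, ∫⁻ y, F k x y ∂μ k ≤ c k) :
    ∫⁻ x, ∏ k ∈ s, F k x (x k) ∂(Measure.pi μ) ≤ ∏ k ∈ s, c k := by
  have key : ∀ t ⊆ s, ∀ x, lmarginal μ t (fun x => ∏ k ∈ t, F k x (x k)) x ≤ ∏ k ∈ t, c k := by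
    intro t
    induction t using Finset.induction_on with
    | empty => intro _ x; simp
    | insert i t hi ih =>
      intro hts x
      have hts' : t ⊆ s := fun a ha => hts (Finset.mem_insert_of_mem ha)
      have his : i ∈ s := hts (Finset.mem_insert_self _ _)
      rw [lmarginal_insert' _ (Finset.measurable_prod _ (fun k _ => hF k)) hi]
      have h1 : (fun x => ∫⁻ xi, ∏ k ∈ insert i t, F k (Function.update x i xi)
          (Function.update x i xi k) ∂μ i) ≤ fun x => c i * ∏ k ∈ t, F k x (x k) := by
        intro x
        have h2 : ∀ xi, ∏ k ∈ insert i t, F k (Function.update x i xi)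
          (Function.update x i xi k) = F i x xi * ∏ k ∈ t, F k x (x k) := by
          intro xi
          rw [Finset.prod_insert hi, hinv i his i his, Function.update_self]
          congr 1
          refine Finset.prod_congr rfl fun k hk => ?_
          rw [hinv k (hts' hk) i his, Function.update_of_ne]
          rintro rfl; exact hi hk
        simp only [h2]
        rw [lintegral_mul_const _ (hF2 i x)]
        gcongr
        exact hc i his x
      refine (lmarginal_mono h1 x).trans ?_
      rw [Finset.prod_insert hi]
      have h3 : lmarginal μ t (fun x => c i * ∏ k ∈ t, F k x (x k)) x
          = c i * lmarginal μ t (fun x => ∏ k ∈ t, F k x (x k)) x := by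
        unfold lmarginal
        rw [lintegral_const_mul]
        exact (Finset.measurable_prod _ (fun k _ => hF k)).comp measurable_updateFinset
      rw [h3]
      gcongr
      exact ih hts' x
  have h0 : ∫⁻ x, ∏ k ∈ s, F k x (x k) ∂(Measure.pi μ) ≤ ∫⁻ x, ∏ k ∈ s, c k ∂(Measure.pi μ) := by
    refine lintegral_le_of_lmarginal_le s (Finset.measurable_prod _ (fun k _ => hF k))
      measurable_const ?_
    intro x
    refine (key s subset_rfl x).trans ?_
    unfold lmarginal
    simp
  simpa using h0

/-- constant version -/
lemma lintegral_pi_prod_le' {ι E : Type*} [Fintype ι] [DecidableEq ι] [MeasurableSpace E]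
    (μ : ι → Measure E) [∀ i, IsProbabilityMeasure (μ i)]
    (F : ι → E → ENNReal) (hF : ∀ k, Measurable (F k))
    (c : ι → ENNReal)
    (hc : ∀ k, ∫⁻ y, F k y ∂μ k ≤ c k) :
    ∫⁻ x, ∏ k, F k (x k) ∂(Measure.pi μ) ≤ ∏ k, c k :=
  lintegral_pi_prod_le μ Finset.univ (fun k _ y => F k y)
    (fun k => (hF k).comp (measurable_pi_apply k)) (fun k _ => hF k) c (by simp) (fun k _ _ => hc k)

lemma lintegral_exp_gauss (v : NNReal) (t : ℝ) :
    ∫⁻ x, ENNReal.ofReal (Real.exp (t * x)) ∂gaussianReal 0 v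
      = ENNReal.ofReal (Real.exp (v * t ^ 2 / 2)) := by
  rw [← ofReal_integral_eq_lintegral_ofReal (integrable_exp_mul_gaussianReal t)
    (ae_of_all _ fun x => (Real.exp_pos _).le)]
  have := congrFun (mgf_id_gaussianReal (μ := 0) (v := v)) t
  simp only [mgf, id] at this
  rw [this]; simp

lemma one_sub_ge_exp {x : ℝ} (h1 : -(1/2) ≤ x) (h2 : x ≤ 1/2) :
    Real.exp (-x - x^2) ≤ 1 - x := by
  have e : Real.exp (-x - x^2) = (Real.exp (x + x^2))⁻¹ := by
    rw [← Real.exp_neg]; ring_nf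
  rw [e]
  rw [inv_le_comm₀ (Real.exp_pos _) (by linarith)]
  rcases le_total x 0 with hx | hx
  · have := Real.add_one_le_exp (x + x^2)
    refine le_trans ?_ this
    rw [inv_le_iff_one_le_mul₀ (by linarith)]
    nlinarith [mul_nonneg (neg_nonneg.2 hx) (sq_nonneg x)]
  · have := Real.quadratic_le_exp_of_nonneg (x := x + x^2) (by positivity)
    refine le_trans ?_ this
    rw [inv_le_iff_one_le_mul₀ (by linarith)]
    have h5 : 0 ≤ (1-x)*(1+x)^2/2 - x := by
      nlinarith [mul_nonneg hx (sub_nonneg.2 h2), mul_nonneg hx hx,mul_nonneg (mul_nonneg hx hx) (sub_nonneg.2 h2)]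
    nlinarith [mul_nonneg h5 (sq_nonneg x)]

lemma lintegral_exp_sq (v : NNReal) (θ : ℝ) (h : |θ * v| ≤ 1/4) :
    ∫⁻ x, ENNReal.ofReal (Real.exp (θ * x ^ 2)) ∂gaussianReal 0 v
      ≤ ENNReal.ofReal (Real.exp (θ * v + 2 * (θ * v) ^ 2)) := by
  by_cases hv : v = 0
  · subst hv
    simp
  have hv' : (0:ℝ) < v := by positivity
  obtain ⟨ha, hb⟩ := abs_le.1 h
  have hpos : (0:ℝ) < 1/(2*v) - θ := by
    rw [sub_pos, lt_div_iff₀ (by positivity)]; nlinarith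
  rw [gaussianReal_of_var_ne_zero _ hv, lintegral_withDensity_eq_lintegral_mul _
    (measurable_gaussianPDF _ _) (by fun_prop)]
  have e : ∀ x : ℝ, (gaussianPDF 0 v * fun x => ENNReal.ofReal (Real.exp (θ * x ^ 2))) x
     = ENNReal.ofReal ((√(2 * Real.pi * v))⁻¹ * Real.exp (-(1/(2*v) - θ) * x ^ 2)) := by
    intro x
    simp only [Pi.mul_apply, gaussianPDF, gaussianPDFReal]
    rw [← ENNReal.ofReal_mul (by positivity), mul_assoc, ← Real.exp_add]
    congr 3
    field_simp
    ring
  simp only [e]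
  rw [← ofReal_integral_eq_lintegral_ofReal
    ((integrable_exp_neg_mul_sq hpos).const_mul _) (ae_of_all _ fun x => by positivity),
    integral_const_mul, integral_gaussian]
  apply ENNReal.ofReal_le_ofReal
  rw [← Real.sqrt_inv, ← Real.sqrt_mul (by positivity)]
  have e2 : (2 * Real.pi * (v:ℝ))⁻¹ * (Real.pi / (1/(2*v) - θ)) = (1 - 2*(θ*v))⁻¹ := by
    have : (1 - 2*(θ*v)) ≠ 0 := by linarith
    have h3 : 1/(2*(v:ℝ)) - θ = (1 - 2*(θ*v))/(2*v) := by field_simp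
    rw [h3]
    field_simp
  rw [e2]
  apply Real.sqrt_le_iff.2 ⟨(Real.exp_pos _).le, ?_⟩
  have := one_sub_ge_exp (x := 2*(θ*v)) (by linarith) (by linarith)
  rw [inv_le_comm₀ (by linarith) (by positivity), ← Real.exp_nat_mul, ← Real.exp_neg]
  refine le_trans (le_of_eq ?_) this
  congr 1
  push_cast; ring

lemma map_dot {ι : Type*} [Fintype ι] (v : NNReal) (w : ι → ℝ) :
    (Measure.pi fun _ : ι => gaussianReal 0 v).map (fun u => u ⬝ᵥ w)
      = gaussianReal 0 (v * (w ⬝ᵥ w).toNNReal) := by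
  have hww : 0 ≤ w ⬝ᵥ w := by
    unfold dotProduct; exact Finset.sum_nonneg fun i _ => mul_self_nonneg _
  have hm : Measurable (fun u : ι → ℝ => u ⬝ᵥ w) := by unfold dotProduct; fun_prop
  have : IsProbabilityMeasure ((Measure.pi fun _ : ι => gaussianReal 0 v).map (fun u => u ⬝ᵥ w)) :=
    Measure.isProbabilityMeasure_map hm.aemeasurable
  apply Measure.ext_of_charFun
  ext t
  rw [charFun_apply_real, integral_map hm.aemeasurable (by fun_prop), charFun_gaussianReal]
  unfold dotProduct
  push_cast
  simp_rw [Finset.mul_sum, Finset.sum_mul, Complex.exp_sum]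
  rw [integral_fintype_prod_eq_prod (𝕜 := ℂ) (f := fun i (x : ℝ) => Complex.exp (t * (x * w i) * Complex.I))]
  have e : ∀ i, ∫ x : ℝ, Complex.exp (t * (x * w i) * Complex.I) ∂gaussianReal 0 v
     = Complex.exp (- (v * (w i * w i) * t^2/2)) := by
    intro i
    have := charFun_gaussianReal (μ := 0) (v := v) (t * w i)
    rw [charFun_apply_real] at this
    simp only [Complex.ofReal_mul, Complex.ofReal_zero, mul_zero, zero_mul, zero_sub] at this
    convert this using 2
    · ext x; congr 1; ring
    · ring
  simp_rw [e]
  unfold dotProduct at hww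
  rw [← Complex.exp_sum, Real.coe_toNNReal _ hww]
  congr 1
  push_cast
  simp only [Finset.mul_sum, Finset.sum_mul, Finset.sum_div, Finset.sum_neg_distrib]
  simp

lemma dot_self_nonneg' {ι : Type*} [Fintype ι] (w : ι → ℝ) : 0 ≤ w ⬝ᵥ w := by
  unfold dotProduct; exact Finset.sum_nonneg fun i _ => mul_self_nonneg _

@[fun_prop]
lemma measurable_dot {ι Ω : Type*} [Fintype ι] [MeasurableSpace Ω] {f g : Ω → ι → ℝ}
    (hf : Measurable f) (hg : Measurable g) : Measurable fun x => f x ⬝ᵥ g x := by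
  unfold dotProduct; fun_prop

lemma vec_exp_dot {ι : Type*} [Fintype ι] (v : NNReal) (w : ι → ℝ) (t : ℝ) :
    ∫⁻ u, ENNReal.ofReal (Real.exp (t * (u ⬝ᵥ w))) ∂(Measure.pi fun _ : ι => gaussianReal 0 v)
      = ENNReal.ofReal (Real.exp (v * (w ⬝ᵥ w) * t ^ 2 / 2)) := by
  have h := lintegral_exp_gauss (v * (w ⬝ᵥ w).toNNReal) t
  rw [← map_dot, lintegral_map (by fun_prop) (by fun_prop)] at h
  rw [h, NNReal.coe_mul, Real.coe_toNNReal _ (dot_self_nonneg' w)]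

lemma vec_exp_dot_sq {ι : Type*} [Fintype ι] (v : NNReal) (w : ι → ℝ) (θ : ℝ)
    (hθ : |θ * (v * (w ⬝ᵥ w))| ≤ 1/4) :
    ∫⁻ u, ENNReal.ofReal (Real.exp (θ * (u ⬝ᵥ w) ^ 2)) ∂(Measure.pi fun _ : ι => gaussianReal 0 v)
      ≤ ENNReal.ofReal (Real.exp (θ * (v * (w ⬝ᵥ w)) + 2 * (θ * (v * (w ⬝ᵥ w))) ^ 2)) := by
  have e : ((v * (w ⬝ᵥ w).toNNReal : NNReal) : ℝ) = v * (w ⬝ᵥ w) := by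
    rw [NNReal.coe_mul, Real.coe_toNNReal _ (dot_self_nonneg' w)]
  have h := lintegral_exp_sq (v * (w ⬝ᵥ w).toNNReal) θ (by rw [e]; exact hθ)
  rw [← map_dot, lintegral_map (by fun_prop) (by fun_prop)] at h
  rwa [e] at h

lemma vec_exp_norm {ι : Type*} [Fintype ι] (v : NNReal) (θ : ℝ) (hθ : |θ * v| ≤ 1/4) :
    ∫⁻ u, ENNReal.ofReal (Real.exp (θ * (u ⬝ᵥ u))) ∂(Measure.pi fun _ : ι => gaussianReal 0 v)
      ≤ ENNReal.ofReal (Real.exp (Fintype.card ι * (θ * v + 2 * (θ * v) ^ 2))) := by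
  classical
  have h := lintegral_pi_prod_le' (fun _ : ι => gaussianReal 0 v)
    (fun _ x => ENNReal.ofReal (Real.exp (θ * x ^ 2))) (fun _ => by fun_prop)
    (fun _ => ENNReal.ofReal (Real.exp (θ * v + 2 * (θ * v) ^ 2)))
    (fun _ => lintegral_exp_sq v θ hθ)
  rw [Finset.prod_const, ← ENNReal.ofReal_pow (Real.exp_pos _).le, ← Real.exp_nat_mul] at h
  refine le_trans (le_of_eq ?_) h
  refine lintegral_congr fun u => ?_
  rw [← ENNReal.ofReal_prod_of_nonneg (fun _ _ => (Real.exp_pos _).le), ← Real.exp_sum]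
  unfold dotProduct
  rw [Finset.mul_sum]
  simp only [pow_two]

lemma chernoff {Ω : Type*} [MeasurableSpace Ω] (μ : Measure Ω) (f : Ω → ℝ) (hf : Measurable f)
    (a B : ℝ) (h : ∫⁻ x, ENNReal.ofReal (Real.exp (f x)) ∂μ ≤ ENNReal.ofReal (Real.exp B)) :
    μ {x | a ≤ f x} ≤ ENNReal.ofReal (Real.exp (B - a)) := by
  have h1 := meas_ge_le_lintegral_div (μ := μ) (f := fun x => ENNReal.ofReal (Real.exp (f x)))
    (by fun_prop) (ε := ENNReal.ofReal (Real.exp a)) (by simp [Real.exp_pos]) (by simp)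
  have e : {x | a ≤ f x} = {x | ENNReal.ofReal (Real.exp a) ≤ ENNReal.ofReal (Real.exp (f x))} := by
    ext x; simp [ENNReal.ofReal_le_ofReal_iff (Real.exp_pos _).le]
  rw [e]
  refine h1.trans ?_
  rw [Real.exp_sub, ENNReal.ofReal_div_of_pos (Real.exp_pos _)]
  gcongr

instance (d : ℕ) : IsProbabilityMeasure (stdGaussianVec d) := by
  unfold stdGaussianVec; infer_instance

lemma vec_tail (d : ℕ) (hd : 0 < d) (θ a : ℝ) (hθ : |θ| ≤ 1/4) :
    stdGaussianVec d {u | a ≤ θ * d * (u ⬝ᵥ u)} ≤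
      ENNReal.ofReal (Real.exp (d * (θ + 2 * θ ^ 2) - a)) := by
  have hd' : (0:ℝ) < d := by exact_mod_cast hd
  have e : θ * d * ((d : NNReal)⁻¹ : NNReal) = θ := by push_cast; field_simp
  refine chernoff _ _ (by fun_prop) _ _ ?_
  have := vec_exp_norm (ι := Fin d) (d : NNReal)⁻¹ (θ * d) (by rw [e]; exact hθ)
  rw [e, Fintype.card_fin] at this
  exact this

lemma vec_tail_upper (d : ℕ) (hd : 0 < d) (ε : ℝ) (h0 : 0 < ε) (h1 : ε ≤ 1) :
    stdGaussianVec d {u | 1 + ε ≤ u ⬝ᵥ u} ≤ ENNReal.ofReal (Real.exp (- (d * ε ^ 2 / 8))) := by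
  have hd' : (0:ℝ) < d := by exact_mod_cast hd
  have := vec_tail d hd (ε / 4) (ε / 4 * d * (1 + ε)) (by rw [abs_of_pos (by positivity)]; linarith)
  refine le_trans (measure_mono ?_) (this.trans (ENNReal.ofReal_le_ofReal (Real.exp_le_exp.2 ?_)))
  · intro u hu
    simp only [Set.mem_ofPred_eq] at hu ⊢
    gcongr
  · nlinarith

lemma vec_tail_lower (d : ℕ) (hd : 0 < d) (ε : ℝ) (h0 : 0 < ε) (h1 : ε ≤ 1) :
    stdGaussianVec d {u | u ⬝ᵥ u ≤ 1 - ε} ≤ ENNReal.ofReal (Real.exp (- (d * ε ^ 2 / 8))) := by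
  have hd' : (0:ℝ) < d := by exact_mod_cast hd
  have := vec_tail d hd (-(ε / 4)) (-(ε / 4) * d * (1 - ε))
    (by rw [abs_neg, abs_of_pos (by positivity)]; linarith)
  refine le_trans (measure_mono ?_) (this.trans (ENNReal.ofReal_le_ofReal (Real.exp_le_exp.2 ?_)))
  · intro u hu
    simp only [Set.mem_ofPred_eq] at hu ⊢
    have : 0 ≤ ε / 4 * d := by positivity
    nlinarith
  · nlinarith

lemma vec_tail_big (d : ℕ) (hd : 0 < d) (a : ℝ) :
    stdGaussianVec d {u | a ≤ u ⬝ᵥ u} ≤ ENNReal.ofReal (Real.exp (d * (3/8 - a/4))) := by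
  have hd' : (0:ℝ) < d := by exact_mod_cast hd
  have := vec_tail d hd (1/4) (1/4 * d * a) (by rw [abs_of_pos (by positivity)])
  refine le_trans (measure_mono ?_) (this.trans (ENNReal.ofReal_le_ofReal (Real.exp_le_exp.2 ?_)))
  · intro u hu
    simp only [Set.mem_ofPred_eq] at hu ⊢
    gcongr
  · nlinarith

/-- law of `n` vectors -/
def gm (d n : ℕ) : Measure (Fin n → Fin d → ℝ) := Measure.pi fun _ : Fin n => stdGaussianVec d

instance (d n : ℕ) : IsProbabilityMeasure (gm d n) := by
  unfold gm; infer_instance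

lemma gm_coord (d n : ℕ) (i : Fin n) (A : Set (Fin d → ℝ)) (hA : MeasurableSet A) :
    gm d n {x | x i ∈ A} = stdGaussianVec d A := by
  have := (measurePreserving_eval (fun _ : Fin n => stdGaussianVec d) i).measure_preimage
    hA.nullMeasurableSet
  exact this

lemma prob_dot (d n : ℕ) (hd : 0 < d) (i j : Fin n) (hij : i ≠ j) (σ : ℝ) (hσ : σ ^ 2 = 1)
    (ε : ℝ) (hε : 0 < ε) :
    gm d n {x | x i ⬝ᵥ x i ≤ 2 ∧ ε ≤ σ * (x j ⬝ᵥ x i)} ≤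
      ENNReal.ofReal (Real.exp (- (d * ε ^ 2 / 4))) := by
  classical
  have hd' : (0:ℝ) < d := by exact_mod_cast hd
  set w : (Fin n → Fin d → ℝ) → Fin d → ℝ := fun x => if x i ⬝ᵥ x i ≤ 2 then x i else 0 with hw
  have hwm : Measurable w := by
    refine Measurable.ite (measurableSet_le (by fun_prop) (by fun_prop)) (by fun_prop) (by fun_prop)
  have hw2 : ∀ x, w x ⬝ᵥ w x ≤ 2 := by
    intro x; simp only [hw]; split_ifs with h
    · exact h
    · simp
  set t := ε * d / 2 * σ with ht
  have key := lintegral_pi_prod_le (fun _ : Fin n => stdGaussianVec d) {j}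
    (fun k x y => ENNReal.ofReal (Real.exp (t * (y ⬝ᵥ w x))))
    (fun k => by fun_prop) (fun k x => by fun_prop)
    (fun _ => ENNReal.ofReal (Real.exp (d * ε ^ 2 / 4)))
    (by
      intro k hk l hl x y
      simp only [Finset.mem_singleton] at hl
      subst hl
      simp only [hw, Function.update_of_ne hij])
    (by
      intro k hk x
      rw [stdGaussianVec, vec_exp_dot]
      refine ENNReal.ofReal_le_ofReal (Real.exp_le_exp.2 ?_)
      have e : t ^ 2 = ε ^ 2 * d ^ 2 / 4 := by rw [ht, mul_pow, hσ]; ring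
      rw [e]
      push_cast
      have := hw2 x
      calc (d:ℝ)⁻¹ * (w x ⬝ᵥ w x) * (ε ^ 2 * d ^ 2 / 4) / 2 ≤
        (d:ℝ)⁻¹ * 2 * (ε ^ 2 * d ^ 2 / 4) / 2 := by gcongr
        _ = _ := by field_simp)
  simp only [Finset.prod_singleton] at key
  have h2 := chernoff _ _ (by fun_prop) (ε * d / 2 * ε) _ key
  refine le_trans (measure_mono ?_) (h2.trans (ENNReal.ofReal_le_ofReal (Real.exp_le_exp.2 ?_)))
  · rintro x ⟨hx1, hx2⟩
    simp only [Set.mem_ofPred_eq, hw, hx1, if_true, ht]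
    calc ε * d / 2 * ε ≤ ε * d / 2 * (σ * (x j ⬝ᵥ x i)) := by gcongr
      _ = _ := by ring
  · nlinarith

lemma gaussianModel_eq (d n : ℕ) : gaussianModel d n = (gm d n).prod (gm d n) := rfl

instance (d n : ℕ) : IsProbabilityMeasure (gaussianModel d n) := by
  rw [gaussianModel_eq]; infer_instance

/-- the noise term -/
def noise {d n : ℕ} (i j : Fin n) (U V : Fin n → Fin d → ℝ) : ℝ :=
  ∑ k ∈ (Finset.univ \ {i, j} : Finset (Fin n)), (U k ⬝ᵥ (U i - U j)) * (V k ⬝ᵥ V i)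

lemma exp_sum_prod {ι : Type*} (s : Finset ι) (f : ι → ℝ) :
    ENNReal.ofReal (Real.exp (∑ k ∈ s, f k)) = ∏ k ∈ s, ENNReal.ofReal (Real.exp (f k)) := by
  rw [Real.exp_sum, ENNReal.ofReal_prod_of_nonneg (fun _ _ => (Real.exp_pos _).le)]

lemma prob_noise (d n : ℕ) (hd : 0 < d) (i j : Fin n) (l b s : ℝ)
    (hl : 0 < l) (hb : 0 ≤ b) (hy : l ^ 2 * b ^ 2 / d ^ 2 ≤ 1 / 4) :
    gaussianModel d n {p | p.2 i ⬝ᵥ p.2 i ≤ b ∧ (p.1 i - p.1 j) ⬝ᵥ (p.1 i - p.1 j) ≤ 2 * b ∧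
      noise i j p.1 p.2 ≤ - s} ≤
      ENNReal.ofReal (Real.exp (n * (l ^ 2 * b ^ 2 / d ^ 2 + 2 * (l ^ 2 * b ^ 2 / d ^ 2) ^ 2)
        - l * s)) := by
  classical
  have hd' : (0:ℝ) < d := by exact_mod_cast hd
  set y0 := l ^ 2 * b ^ 2 / d ^ 2 with hy0
  set z : (Fin n → Fin d → ℝ) → Fin d → ℝ := fun x => if x i ⬝ᵥ x i ≤ b then x i else 0 with hz
  have hzm : Measurable z := by
    refine Measurable.ite (measurableSet_le (by fun_prop) (by fun_prop)) (by fun_prop) (by fun_prop)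
  have hz2 : ∀ x, z x ⬝ᵥ z x ≤ b := by
    intro x; simp only [hz]; split_ifs with h
    · exact h
    · simpa using hb
  set w : (Fin n → Fin d → ℝ) → Fin d → ℝ := fun x =>
    if (x i - x j) ⬝ᵥ (x i - x j) ≤ 2 * b then x i - x j else 0 with hw
  have hwm : Measurable w := by
    refine Measurable.ite (measurableSet_le (by fun_prop) (by fun_prop)) (by fun_prop) (by fun_prop)
  have hw2 : ∀ x, w x ⬝ᵥ w x ≤ 2 * b := by
    intro x; simp only [hw]; split_ifs with h
    · exact h
    · simpa using hb
  set S : Finset (Fin n) := Finset.univ \ {i, j} with hS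
  have hiS : ∀ k ∈ S, i ≠ k := by
    intro k hk; simp [hS] at hk; exact fun h => hk.1 h.symm
  have hjS : ∀ k ∈ S, j ≠ k := by
    intro k hk; simp [hS] at hk; exact fun h => hk.2 h.symm
  set f : (Fin n → Fin d → ℝ) × (Fin n → Fin d → ℝ) → ℝ := fun p =>
    ∑ k ∈ S, (-l * (p.1 k ⬝ᵥ w p.1)) * (p.2 k ⬝ᵥ z p.2) with hf
  have hfm : Measurable f := by fun_prop
  have h1 : ∀ U, ∫⁻ V, ENNReal.ofReal (Real.exp (f (U, V))) ∂(gm d n) ≤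
      ∏ k ∈ S, ENNReal.ofReal (Real.exp (b * l ^ 2 / (2 * d) * (U k ⬝ᵥ w U) ^ 2)) := by
    intro U
    simp only [hf, exp_sum_prod]
    refine lintegral_pi_prod_le (fun _ : Fin n => stdGaussianVec d) S
      (fun k x y => ENNReal.ofReal (Real.exp ((-l * (U k ⬝ᵥ w U)) * (y ⬝ᵥ z x))))
      (fun k => by fun_prop) (fun k x => by fun_prop) _ ?_ ?_
    · intro k hk m hm x y
      simp only [hz, Function.update_of_ne (hiS m hm)]
    · intro k hk x
      rw [stdGaussianVec, vec_exp_dot]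
      refine ENNReal.ofReal_le_ofReal (Real.exp_le_exp.2 ?_)
      push_cast
      have := hz2 x
      calc (d:ℝ)⁻¹ * (z x ⬝ᵥ z x) * (-l * (U k ⬝ᵥ w U)) ^ 2 / 2 ≤
        (d:ℝ)⁻¹ * b * (-l * (U k ⬝ᵥ w U)) ^ 2 / 2 := by gcongr
        _ = _ := by field_simp
  have h2 : ∫⁻ U, ∏ k ∈ S, ENNReal.ofReal (Real.exp (b * l ^ 2 / (2 * d) * (U k ⬝ᵥ w U) ^ 2))
      ∂(gm d n) ≤ ∏ k ∈ S, ENNReal.ofReal (Real.exp (y0 + 2 * y0 ^ 2)) := by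
    refine lintegral_pi_prod_le (fun _ : Fin n => stdGaussianVec d) S
      (fun k x y => ENNReal.ofReal (Real.exp (b * l ^ 2 / (2 * d) * (y ⬝ᵥ w x) ^ 2)))
      (fun k => by fun_prop) (fun k x => by fun_prop) _ ?_ ?_
    · intro k hk m hm x y
      simp only [hw, Function.update_of_ne (hiS m hm), Function.update_of_ne (hjS m hm)]
    · intro k hk x
      have q0 : 0 ≤ b * l ^ 2 / (2 * d) * (((d:NNReal)⁻¹ : NNReal) * (w x ⬝ᵥ w x)) := by
        have := dot_self_nonneg' (w x)
        positivity
      have q1 : b * l ^ 2 / (2 * d) * (((d:NNReal)⁻¹ : NNReal) * (w x ⬝ᵥ w x)) ≤ y0 := by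
        have := hw2 x
        calc b * l ^ 2 / (2 * d) * (((d:NNReal)⁻¹ : NNReal) * (w x ⬝ᵥ w x)) ≤
          b * l ^ 2 / (2 * d) * (((d:NNReal)⁻¹ : NNReal) * (2 * b)) := by gcongr
          _ = y0 := by rw [hy0]; push_cast; field_simp
      refine (vec_exp_dot_sq _ _ _ ?_).trans ?_
      · rw [abs_of_nonneg q0]; linarith
      · refine ENNReal.ofReal_le_ofReal (Real.exp_le_exp.2 ?_)
        gcongr
  have h3 : ∏ k ∈ S, ENNReal.ofReal (Real.exp (y0 + 2 * y0 ^ 2)) ≤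
      ENNReal.ofReal (Real.exp (n * (y0 + 2 * y0 ^ 2))) := by
    rw [← exp_sum_prod]
    refine ENNReal.ofReal_le_ofReal (Real.exp_le_exp.2 ?_)
    rw [Finset.sum_const, nsmul_eq_mul]
    have : S.card ≤ n := by simpa using Finset.card_le_univ S
    have : (S.card : ℝ) ≤ n := by exact_mod_cast this
    gcongr
  have h4 : ∫⁻ p, ENNReal.ofReal (Real.exp (f p)) ∂(gaussianModel d n) ≤
      ENNReal.ofReal (Real.exp (n * (y0 + 2 * y0 ^ 2))) := by
    rw [gaussianModel_eq, lintegral_prod _ (by fun_prop)]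
    exact (lintegral_mono h1).trans (h2.trans h3)
  refine le_trans (measure_mono ?_) (chernoff _ f hfm (l * s) _ h4)
  rintro ⟨U, V⟩ ⟨hp1, hp2, hp3⟩
  simp only [Set.mem_ofPred_eq] at hp1 hp2 hp3 ⊢
  have : f (U, V) = -l * noise i j U V := by
    simp only [hf, noise, hz, hw, hp1, hp2, if_true, Finset.mul_sum]
    refine Finset.sum_congr rfl fun k _ => by ring
  rw [this]
  nlinarith

lemma score_hebb {d n : ℕ} (U V : Fin n → Fin d → ℝ) (i j : Fin n) :
    score U V (∑ k, vecMulVec (U k) (V k)) j i = ∑ k, (U j ⬝ᵥ U k) * (V k ⬝ᵥ V i) := by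
  unfold score
  rw [Matrix.sum_mulVec, dotProduct_sum]
  refine Finset.sum_congr rfl fun k _ => ?_
  rw [Matrix.vecMulVec_mulVec]
  simp [mul_comm]

lemma score_diff {d n : ℕ} (U V : Fin n → Fin d → ℝ) (i j : Fin n) (hij : i ≠ j) :
    score U V (∑ k, vecMulVec (U k) (V k)) i i - score U V (∑ k, vecMulVec (U k) (V k)) j i
     = (U i ⬝ᵥ U i) * (V i ⬝ᵥ V i) - (U i ⬝ᵥ U j) * (V i ⬝ᵥ V i)
       + ((U i ⬝ᵥ U j) - (U j ⬝ᵥ U j)) * (V j ⬝ᵥ V i) + noise i j U V := by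
  classical
  rw [score_hebb, score_hebb, ← Finset.sum_sub_distrib, noise,
    ← Finset.sum_sdiff (Finset.subset_univ {i, j})]
  rw [Finset.sum_pair hij, add_comm]
  congr 1
  · rw [dotProduct_comm (U j) (U i)]; ring
  · refine Finset.sum_congr rfl fun k _ => ?_
    rw [dotProduct_sub, dotProduct_comm (U k), dotProduct_comm (U k)]; ring

/-- deterministic part of (i) -/
lemma mem_PR {d n : ℕ} (U V : Fin n → Fin d → ℝ) (ε : ℝ) (h0 : 0 < ε) (h1 : ε ≤ 1/10)
    (hU1 : ∀ i, 1 - ε < U i ⬝ᵥ U i) (hU2 : ∀ i, U i ⬝ᵥ U i < 1 + ε)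
    (hV1 : ∀ i, 1 - ε < V i ⬝ᵥ V i) (hV2 : ∀ i, V i ⬝ᵥ V i < 1 + ε)
    (hU3 : ∀ i j, i ≠ j → U j ⬝ᵥ U i < ε) (hU4 : ∀ i j, i ≠ j → -1 * (U j ⬝ᵥ U i) < ε)
    (hV3 : ∀ i j, i ≠ j → V j ⬝ᵥ V i < ε) (hV4 : ∀ i j, i ≠ j → -1 * (V j ⬝ᵥ V i) < ε)
    (hN : ∀ i j, i ≠ j → V i ⬝ᵥ V i ≤ 1 + 2 * ε → (U i - U j) ⬝ᵥ (U i - U j) ≤ 2 * (1 + 2 * ε) →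
      -(1 - 10 * ε) < noise i j U V) :
    (U, V) ∈ PRset d n := by
  refine ⟨∑ k, vecMulVec (U k) (V k), fun i j hji => ?_⟩
  rw [← sub_pos, score_diff U V i j hji.symm]
  have a1 := hU1 i
  have a2 := hU2 i
  have b1 := hV1 i
  have b2 := hV2 i
  have c1 := hU1 j
  have c2 := hU2 j
  have e1 := hU3 j i hji
  have e2 := hU4 j i hji
  have f1 := hV3 i j hji.symm
  have f2 := hV4 i j hji.symm
  have g := hN i j hji.symm (by linarith) (by
    rw [sub_dotProduct, dotProduct_sub, dotProduct_sub, dotProduct_comm (U j) (U i)]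
    linarith)
  generalize noise i j U V = N at *
  generalize U i ⬝ᵥ U i = ui at *
  generalize U j ⬝ᵥ U j = uj at *
  generalize V i ⬝ᵥ V i = vi at *
  generalize U i ⬝ᵥ U j = x at *
  generalize V j ⬝ᵥ V i = y at *
  have t1 : (1 - 2 * ε) * (1 - ε) ≤ (ui - x) * vi := by
    have : 1 - 2 * ε ≤ ui - x := by linarith
    exact mul_le_mul this b1.le (by linarith) (by linarith)
  have t2 : |(x - uj) * y| ≤ (1 + 2 * ε) * ε := by
    rw [abs_mul]
    refine mul_le_mul ?_ ?_ (abs_nonneg _) (by linarith)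
    · rw [abs_le]; constructor <;> linarith
    · rw [abs_le]; constructor <;> linarith
  have t3 := (abs_le.1 t2).1
  nlinarith

lemma gmodel_fst (d n : ℕ) (A : Set (Fin n → Fin d → ℝ)) :
    gaussianModel d n {p | p.1 ∈ A} = gm d n A := by
  have : {p : (Fin n → Fin d → ℝ) × (Fin n → Fin d → ℝ) | p.1 ∈ A} = A ×ˢ Set.univ := by
    ext p; simp
  rw [this, gaussianModel_eq, Measure.prod_prod]; simp

lemma gmodel_snd (d n : ℕ) (A : Set (Fin n → Fin d → ℝ)) :
    gaussianModel d n {p | p.2 ∈ A} = gm d n A := by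
  have : {p : (Fin n → Fin d → ℝ) × (Fin n → Fin d → ℝ) | p.2 ∈ A} = Set.univ ×ˢ A := by
    ext p; simp
  rw [this, gaussianModel_eq, Measure.prod_prod]; simp

lemma union_fin {Ω ι : Type*} [Fintype ι] [MeasurableSpace Ω] (μ : Measure Ω)
    (A : ι → Set Ω) (c : ℝ) (h : ∀ i, μ (A i) ≤ ENNReal.ofReal c) :
    μ {x | ∃ i, x ∈ A i} ≤ ENNReal.ofReal (Fintype.card ι * c) := by
  have e : {x | ∃ i, x ∈ A i} = ⋃ i, A i := by ext; simp
  rw [e]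
  refine (measure_iUnion_fintype_le μ A).trans ?_
  refine (Finset.sum_le_sum (fun i _ => h i)).trans ?_
  rw [Finset.sum_const, ENNReal.ofReal_mul (by positivity)]
  simp

lemma gm_norm_upper (d n : ℕ) (hd : 0 < d) (ε : ℝ) (h0 : 0 < ε) (h1 : ε ≤ 1) :
    gm d n {x | ∃ i, 1 + ε ≤ x i ⬝ᵥ x i} ≤ ENNReal.ofReal (n * Real.exp (- (d * ε ^ 2 / 8))) := by
  have := union_fin (gm d n) (fun i : Fin n => {x | x i ∈ {u : Fin d → ℝ | 1 + ε ≤ u ⬝ᵥ u}}) _ (fun i => by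
    rw [gm_coord _ _ _ _ (measurableSet_le (by fun_prop) (by fun_prop))]
    exact vec_tail_upper d hd ε h0 h1)
  simpa using this

lemma gm_norm_lower (d n : ℕ) (hd : 0 < d) (ε : ℝ) (h0 : 0 < ε) (h1 : ε ≤ 1) :
    gm d n {x | ∃ i, x i ⬝ᵥ x i ≤ 1 - ε} ≤ ENNReal.ofReal (n * Real.exp (- (d * ε ^ 2 / 8))) := by
  have := union_fin (gm d n) (fun i : Fin n => {x | x i ∈ {u : Fin d → ℝ | u ⬝ᵥ u ≤ 1 - ε}}) _ (fun i => by
    rw [gm_coord _ _ _ _ (measurableSet_le (by fun_prop) (by fun_prop))]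
    exact vec_tail_lower d hd ε h0 h1)
  simpa using this

lemma gm_norm_big (d n : ℕ) (hd : 0 < d) (a : ℝ) :
    gm d n {x | ∃ i, a ≤ x i ⬝ᵥ x i} ≤ ENNReal.ofReal (n * Real.exp (d * (3/8 - a/4))) := by
  have := union_fin (gm d n) (fun i : Fin n => {x | x i ∈ {u : Fin d → ℝ | a ≤ u ⬝ᵥ u}}) _ (fun i => by
    rw [gm_coord _ _ _ _ (measurableSet_le (by fun_prop) (by fun_prop))]
    exact vec_tail_big d hd a)
  simpa using this

lemma gm_dot (d n : ℕ) (hd : 0 < d) (σ : ℝ) (hσ : σ ^ 2 = 1) (ε : ℝ) (hε : 0 < ε) :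
    gm d n {x | ∃ q : Fin n × Fin n, q.1 ≠ q.2 ∧ x q.1 ⬝ᵥ x q.1 ≤ 2 ∧ ε ≤ σ * (x q.2 ⬝ᵥ x q.1)}
      ≤ ENNReal.ofReal (n ^ 2 * Real.exp (- (d * ε ^ 2 / 4))) := by
  have := union_fin (gm d n) (fun q : Fin n × Fin n =>
    {x | q.1 ≠ q.2 ∧ x q.1 ⬝ᵥ x q.1 ≤ 2 ∧ ε ≤ σ * (x q.2 ⬝ᵥ x q.1)})
    (Real.exp (- (d * ε ^ 2 / 4))) (fun q => by
    by_cases h : q.1 = q.2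
    · simp [h]
    · simp only [ne_eq, h, not_false_eq_true, true_and]
      exact prob_dot d n hd q.1 q.2 h σ hσ ε hε)
  simpa [pow_two] using this

lemma part1_bound (d n : ℕ) (hd : 0 < d) (ε : ℝ) (h0 : 0 < ε) (h1 : ε ≤ 1/10) (l : ℝ)
    (hl : 0 < l) (hy : l ^ 2 * (1 + 2 * ε) ^ 2 / d ^ 2 ≤ 1 / 4) :
    gaussianModel d n (PRset d n)ᶜ ≤ ENNReal.ofReal
      (4 * (n * Real.exp (- (d * ε ^ 2 / 8))) + 4 * (n ^ 2 * Real.exp (- (d * ε ^ 2 / 4)))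
       + n ^ 2 * Real.exp (n * (l ^ 2 * (1 + 2 * ε) ^ 2 / d ^ 2
          + 2 * (l ^ 2 * (1 + 2 * ε) ^ 2 / d ^ 2) ^ 2) - l * (1 - 10 * ε))) := by
  set P := gaussianModel d n with hP
  set A1 : Set (Fin n → Fin d → ℝ) := {x | ∃ i, 1 + ε ≤ x i ⬝ᵥ x i}
  set A2 : Set (Fin n → Fin d → ℝ) := {x | ∃ i, x i ⬝ᵥ x i ≤ 1 - ε}
  set A3 : Set (Fin n → Fin d → ℝ) :=
    {x | ∃ q : Fin n × Fin n, q.1 ≠ q.2 ∧ x q.1 ⬝ᵥ x q.1 ≤ 2 ∧ ε ≤ 1 * (x q.2 ⬝ᵥ x q.1)}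
  set A4 : Set (Fin n → Fin d → ℝ) :=
    {x | ∃ q : Fin n × Fin n, q.1 ≠ q.2 ∧ x q.1 ⬝ᵥ x q.1 ≤ 2 ∧ ε ≤ -1 * (x q.2 ⬝ᵥ x q.1)}
  set A : Set (Fin n → Fin d → ℝ) := A1 ∪ A2 ∪ (A3 ∪ A4) with hA
  set N : Set ((Fin n → Fin d → ℝ) × (Fin n → Fin d → ℝ)) :=
    {p | ∃ q : Fin n × Fin n, p ∈ {p : (Fin n → Fin d → ℝ) × (Fin n → Fin d → ℝ) |
      p.2 q.1 ⬝ᵥ p.2 q.1 ≤ 1 + 2 * ε ∧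
      (p.1 q.1 - p.1 q.2) ⬝ᵥ (p.1 q.1 - p.1 q.2) ≤ 2 * (1 + 2 * ε) ∧
      noise q.1 q.2 p.1 p.2 ≤ - (1 - 10 * ε)}}
  have hsub : (PRset d n)ᶜ ⊆ {p | p.1 ∈ A} ∪ {p | p.2 ∈ A} ∪ N := by
    rintro ⟨U, V⟩ hp
    by_contra hcon
    apply hp
    simp only [Set.mem_union, not_or, Set.mem_ofPred_eq, hA, A1, A2, A3, A4, N, not_exists,
      not_and, not_le] at hcon
    obtain ⟨⟨⟨⟨u1, u2⟩, u3, u4⟩, ⟨v1, v2⟩, v3, v4⟩, hN⟩ := hcon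
    refine mem_PR U V ε h0 h1 u2 u1 v2 v1 ?_ ?_ ?_ ?_ ?_
    · intro i j hij
      have := u3 (i, j) hij (by linarith [u1 i])
      linarith
    · intro i j hij
      have := u4 (i, j) hij (by linarith [u1 i])
      linarith
    · intro i j hij
      have := v3 (i, j) hij (by linarith [v1 i])
      linarith
    · intro i j hij
      have := v4 (i, j) hij (by linarith [v1 i])
      linarith
    · intro i j _ h2 h3
      exact hN (i, j) h2 h3
  have hAle : gm d n A ≤ ENNReal.ofReal (2 * (n * Real.exp (- (d * ε ^ 2 / 8)))
      + 2 * (n ^ 2 * Real.exp (- (d * ε ^ 2 / 4)))) := by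
    rw [two_mul, two_mul, ENNReal.ofReal_add (by positivity) (by positivity),
      ENNReal.ofReal_add (by positivity) (by positivity),
      ENNReal.ofReal_add (by positivity) (by positivity)]
    refine (measure_union_le _ _).trans (add_le_add ((measure_union_le _ _).trans ?_)
      ((measure_union_le _ _).trans ?_))
    · exact add_le_add (gm_norm_upper d n hd ε h0 (by linarith))
        (gm_norm_lower d n hd ε h0 (by linarith))
    · exact add_le_add (gm_dot d n hd 1 (by norm_num) ε h0) (gm_dot d n hd (-1) (by norm_num) ε h0)
  have hNle : P N ≤ ENNReal.ofReal (n ^ 2 * Real.exp (n * (l ^ 2 * (1 + 2 * ε) ^ 2 / d ^ 2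
          + 2 * (l ^ 2 * (1 + 2 * ε) ^ 2 / d ^ 2) ^ 2) - l * (1 - 10 * ε))) := by
    have := union_fin P _ _ (fun q : Fin n × Fin n =>
      prob_noise d n hd q.1 q.2 l (1 + 2 * ε) (1 - 10 * ε) hl (by linarith) hy)
    simpa only [pow_two, Fintype.card_prod, Fintype.card_fin, Nat.cast_mul] using this
  refine (measure_mono hsub).trans ((measure_union_le _ _).trans ?_)
  rw [ENNReal.ofReal_add (by positivity) (by positivity)]
  refine add_le_add ((measure_union_le _ _).trans ?_) hNle
  rw [hP, gmodel_fst, gmodel_snd]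
  refine (add_le_add hAle hAle).trans (le_of_eq ?_)
  rw [← ENNReal.ofReal_add (by positivity) (by positivity)]
  congr 1; ring

lemma tendsto_one_of_compl {ι : Type*} {l : Filter ι} (P : ι → ENNReal) (Q : ι → ENNReal)
    (h1 : ∀ i, P i ≤ 1) (h : ∀ i, 1 ≤ P i + Q i) (hQ : Tendsto Q l (𝓝 0)) :
    Tendsto P l (𝓝 1) := by
  have : Tendsto (fun i => 1 - Q i) l (𝓝 (1 - 0)) :=
    ENNReal.Tendsto.sub tendsto_const_nhds hQ (Or.inl ENNReal.one_ne_top)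
  rw [tsub_zero] at this
  exact tendsto_of_tendsto_of_tendsto_of_le_of_le this tendsto_const_nhds
    (fun i => tsub_le_iff_right.2 (h i)) h1

lemma tendsto_pow_exp_sqrt (k : ℕ) (c : ℝ) (hc : 0 < c) :
    Tendsto (fun x : ℝ => x ^ k * Real.exp (-(√x * c))) atTop (𝓝 0) := by
  have h := (tendsto_rpow_mul_exp_neg_mul_atTop_nhds_zero ((2 * k : ℕ) : ℝ) c hc).comp
    Real.tendsto_sqrt_atTop
  refine h.congr' ?_
  filter_upwards [eventually_ge_atTop 0] with x hx
  simp only [Function.comp]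
  rw [Real.rpow_natCast, pow_mul, Real.sq_sqrt hx]
  congr 2; ring

lemma tendsto_sq_exp_log (c : ℝ) (hc : 2 < c) :
    Tendsto (fun x : ℝ => x ^ 2 * Real.exp (-(c * Real.log x))) atTop (𝓝 0) := by
  have h : Tendsto (fun x : ℝ => Real.exp (-((c - 2) * Real.log x))) atTop (𝓝 0) :=
    Real.tendsto_exp_neg_atTop_nhds_zero.comp
      (Real.tendsto_log_atTop.const_mul_atTop (by linarith))
  refine h.congr' ?_
  filter_upwards [eventually_gt_atTop 0] with x hx
  have : x ^ 2 = Real.exp (2 * Real.log x) := by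
    rw [two_mul, Real.exp_add, Real.exp_log hx]; ring
  rw [this, ← Real.exp_add]
  congr 1; ring

lemma part1 (ρ₁ : ℝ) (hρ₁ : 8 < ρ₁)
    (n d : ℕ → ℕ) (hn : Tendsto n atTop atTop) (hd : Tendsto d atTop atTop)
    (h : ∀ m, ρ₁ * n m * Real.log (n m) ≤ (d m : ℝ) ^ 2) :
      Tendsto (fun m => gaussianModel (d m) (n m) (PRset (d m) (n m))) atTop
        (𝓝 (1 : ENNReal)) := by
  refine tendsto_one_of_compl _ (fun m => gaussianModel (d m) (n m) (PRset (d m) (n m))ᶜ)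
    (fun m => prob_le_one) ?_ ?_
  · intro m
    have := measure_union_le (μ := gaussianModel (d m) (n m)) (PRset (d m) (n m))
      (PRset (d m) (n m))ᶜ
    rwa [Set.union_compl_self, measure_univ] at this
  set ε := (1 - 8 / ρ₁) / 80 with hε
  have hr : 8 / ρ₁ < 1 := by rw [div_lt_one (by linarith)]; exact hρ₁
  have hr0 : 0 < 8 / ρ₁ := by positivity
  have h0 : 0 < ε := by rw [hε]; linarith
  have h1 : ε ≤ 1 / 80 := by rw [hε]; linarith
  have hexp : (ρ₁ / 4) * (1 - 40 * ε) = ρ₁ / 8 + 1 := by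
    rw [hε]; field_simp; ring
  set g : ℝ → ℝ := fun x => 4 * (x ^ 1 * Real.exp (-(√x * (ε ^ 2 / 8))))
    + 4 * (x ^ 2 * Real.exp (-(√x * (ε ^ 2 / 4))))
    + x ^ 2 * Real.exp (-((ρ₁ / 8 + 1) * Real.log x)) with hg
  have hg0 : Tendsto g atTop (𝓝 0) := by
    have := (((tendsto_pow_exp_sqrt 1 (ε ^ 2 / 8) (by positivity)).const_mul 4).add
      ((tendsto_pow_exp_sqrt 2 (ε ^ 2 / 4) (by positivity)).const_mul 4)).add
      (tendsto_sq_exp_log (ρ₁ / 8 + 1) (by linarith))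
    simpa [hg] using this
  have hnr : Tendsto (fun m => (n m : ℝ)) atTop atTop := tendsto_natCast_atTop_atTop.comp hn
  have hlim : Tendsto (fun m => ENNReal.ofReal (g (n m))) atTop (𝓝 0) := by
    have := ENNReal.tendsto_ofReal (hg0.comp hnr)
    simpa using this
  have hlogn : Tendsto (fun x : ℝ => Real.log x / x) atTop (𝓝 0) := by
    simpa using Real.isLittleO_log_id_atTop.tendsto_div_nhds_zero
  have hy0 : ∀ᶠ m in atTop, ρ₁ / 4 * (1 + 2 * ε) ^ 2 * (Real.log (n m) / n m) ≤ ε / 2 := by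
    have := (hlogn.comp hnr).const_mul (ρ₁ / 4 * (1 + 2 * ε) ^ 2)
    rw [mul_zero] at this
    exact this.eventually_le_const (by positivity)
  refine tendsto_of_tendsto_of_tendsto_of_le_of_le' tendsto_const_nhds hlim
    (Eventually.of_forall fun _ => zero_le) ?_
  filter_upwards [hnr.eventually_ge_atTop 3, hd.eventually_gt_atTop 0, hy0] with m hm hdm hym
  have hN := h m
  generalize n m = N at *
  generalize d m = D at *
  have hD : (0:ℝ) < D := by exact_mod_cast hdm
  have hlog : 1 ≤ Real.log N := by
    rw [Real.le_log_iff_exp_le (by linarith)]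
    exact (Real.exp_one_lt_d9.le.trans (by norm_num)).trans hm
  set L := Real.log N with hL
  have hN0 : (0:ℝ) < N := by linarith
  set l := ρ₁ / 2 * L with hl
  have hl0 : 0 < l := by positivity
  set y := l ^ 2 * (1 + 2 * ε) ^ 2 / D ^ 2 with hy
  have hyle : y ≤ ρ₁ / 4 * (1 + 2 * ε) ^ 2 * (L / N) := by
    calc y ≤ l ^ 2 * (1 + 2 * ε) ^ 2 / (ρ₁ * N * L) := by rw [hy]; gcongr
      _ = _ := by rw [hl]; field_simp; ring
  have hyn : 0 ≤ y := by positivity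
  have hsq : √(N:ℝ) ≤ D := by
    rw [Real.sqrt_le_left hD.le]
    refine le_trans ?_ hN
    have : (N:ℝ) ≤ ρ₁ * N * 1 := by nlinarith
    refine this.trans ?_
    gcongr
  refine (part1_bound D N hdm ε h0 (by linarith) l hl0 (by linarith)).trans
    (ENNReal.ofReal_le_ofReal ?_)
  simp only [hg, pow_one]
  gcongr ?_ + ?_ + (N:ℝ) ^ 2 * Real.exp ?_
  · gcongr 4 * (_ * Real.exp (- ?_))
    rw [mul_div_assoc]; gcongr
  · gcongr 4 * (_ * Real.exp (- ?_))
    rw [mul_div_assoc]; gcongr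
  · have s1 : (N:ℝ) * (y + 2 * y ^ 2) ≤ N * (y * (1 + ε)) := by
      gcongr
      nlinarith
    have s2 : (N:ℝ) * (y * (1 + ε)) ≤ N * ((ρ₁ / 4 * (1 + 2 * ε) ^ 2 * (L / N)) * (1 + ε)) := by
      gcongr
    have s3 : (N:ℝ) * ((ρ₁ / 4 * (1 + 2 * ε) ^ 2 * (L / N)) * (1 + ε))
        = ρ₁ / 4 * L * ((1 + 2 * ε) ^ 2 * (1 + ε)) := by field_simp
    have s4 : (1 + 2 * ε) ^ 2 * (1 + ε) - 2 * (1 - 10 * ε) ≤ -(1 - 40 * ε) := by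
      nlinarith [mul_pos h0 h0, mul_pos (mul_pos h0 h0) h0]
    have s5 : 0 ≤ ρ₁ / 4 * L := by positivity
    have s6 := mul_le_mul_of_nonneg_left s4 s5
    have s7 : ρ₁ / 4 * L * -(1 - 40 * ε) = -((ρ₁ / 8 + 1) * L) := by
      rw [← hexp]; ring
    rw [s7] at s6
    have s8 : l * (1 - 10 * ε) = ρ₁ / 4 * L * (2 * (1 - 10 * ε)) := by rw [hl]; ring
    rw [s8]
    linarith

lemma pi_swap {ι κ : Type*} [Fintype ι] [Fintype κ] (ν : Measure ℝ) [IsProbabilityMeasure ν] :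
    (Measure.pi fun _ : ι × κ => ν).map (fun f (p : κ × ι) => f p.swap)
      = Measure.pi fun _ : κ × ι => ν := by
  symm
  apply Measure.pi_eq
  intro s hs
  rw [Measure.map_apply (by fun_prop) (MeasurableSet.univ_pi hs)]
  have e : (fun (f : ι × κ → ℝ) (p : κ × ι) => f p.swap) ⁻¹' Set.pi Set.univ s
    = Set.pi Set.univ (fun q : ι × κ => s q.swap) := by
    ext f
    simp only [Set.mem_preimage, Set.mem_pi, Set.mem_univ, true_imp_iff]
    exact ⟨fun h q => h q.swap, fun h q => h q.swap⟩
  rw [e, Measure.pi_pi]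
  exact Fintype.prod_equiv (Equiv.prodComm ι κ) _ _ (fun _ => rfl)

lemma pi_curry {ι κ : Type*} [Fintype ι] [Fintype κ] (ν : Measure ℝ) [IsProbabilityMeasure ν] :
    (Measure.pi fun _ : ι × κ => ν).map Function.curry
      = Measure.pi fun _ : ι => Measure.pi fun _ : κ => ν := by
  have h := Measure.infinitePi_map_curry (fun (_ : ι) (_ : κ) => ν)
  simp only [Measure.infinitePi_eq_pi] at h
  exact h

lemma pi_transpose {ι κ : Type*} [Fintype ι] [Fintype κ] (ν : Measure ℝ) [IsProbabilityMeasure ν] :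
    (Measure.pi fun _ : ι => Measure.pi fun _ : κ => ν).map (fun f k i => f i k)
      = Measure.pi fun _ : κ => Measure.pi fun _ : ι => ν := by
  have m1 : Measurable (Function.curry : (ι × κ → ℝ) → ι → κ → ℝ) :=
    measurable_pi_lambda _ fun i => measurable_pi_lambda _ fun k => measurable_pi_apply (i, k)
  have m2 : Measurable (Function.curry : (κ × ι → ℝ) → κ → ι → ℝ) :=
    measurable_pi_lambda _ fun i => measurable_pi_lambda _ fun k => measurable_pi_apply (i, k)
  have m3 : Measurable (fun (f : ι → κ → ℝ) k i => f i k) := by fun_prop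
  have m4 : Measurable (fun (f : ι × κ → ℝ) (p : κ × ι) => f p.swap) := by fun_prop
  rw [← pi_curry (ι := ι) (κ := κ), ← pi_curry (ι := κ) (κ := ι), ← pi_swap (ι := ι) (κ := κ),
    Measure.map_map m3 m1, Measure.map_map m2 m4]
  rfl

lemma jensen_vec {ι κ : Type*} [Fintype ι] [Fintype κ] (v : NNReal) (hv : 0 < v)
    (a : κ → ι → ℝ) (R θ : ℝ)
    (hR : ∑ k, a k ⬝ᵥ a k ≤ R) (hR0 : 0 < R) (h0 : 0 ≤ θ) (h1 : θ ≤ 1/4) :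
    ∫⁻ y, ENNReal.ofReal (Real.exp (θ / (v * R) * ∑ k, (y ⬝ᵥ a k) ^ 2))
      ∂(Measure.pi fun _ : ι => gaussianReal 0 v)
      ≤ ENNReal.ofReal (Real.exp (θ + 2 * θ ^ 2)) := by
  have hv' : (0:ℝ) < v := hv
  set q : κ → ℝ := fun k => a k ⬝ᵥ a k with hq
  have hq0 : ∀ k, 0 ≤ q k := fun k => dot_self_nonneg' _
  set c : κ → ℝ := fun k => θ / (v * q k) with hc
  set p : Option κ → ℝ := fun o => o.elim (1 - ∑ k, q k / R) (fun k => q k / R) with hp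
  have hsum : ∑ k, q k / R ≤ 1 := by
    rw [← Finset.sum_div, div_le_one hR0]; exact hR
  have hp0 : ∀ o, 0 ≤ p o := by
    rintro (_ | k)
    · simp only [hp, Option.elim]; linarith
    · simp only [hp, Option.elim]; exact div_nonneg (hq0 k) hR0.le
  have hp1 : ∑ o, p o = 1 := by
    rw [Fintype.sum_option]; simp [hp]
  set Y : Option κ → (ι → ℝ) → ℝ := fun o y => o.elim 0 (fun k => c k * (y ⬝ᵥ a k) ^ 2) with hY
  have hYm : ∀ o, Measurable (Y o) := by
    rintro (_ | k)
    · simp only [hY, Option.elim]; fun_prop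
    · simp only [hY, Option.elim]; fun_prop
  have hYint : ∀ o, ∫⁻ y, ENNReal.ofReal (Real.exp (Y o y))
      ∂(Measure.pi fun _ : ι => gaussianReal 0 v) ≤ ENNReal.ofReal (Real.exp (θ + 2 * θ ^ 2)) := by
    have h1e : (1 : ℝ) ≤ Real.exp (θ + 2 * θ ^ 2) := Real.one_le_exp (by positivity)
    rintro (_ | k)
    · simpa [hY] using h1e
    · simp only [hY, Option.elim]
      by_cases hk : q k = 0
      · have : c k = 0 := by simp [hc, hk]
        simpa [this] using h1e
      · have e : c k * (v * (a k ⬝ᵥ a k)) = θ := by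
          have : a k ⬝ᵥ a k = q k := rfl
          rw [this]; simp only [hc]; field_simp
        have := vec_exp_dot_sq v (a k) (c k) (by rw [e, abs_of_nonneg h0]; exact h1)
        rwa [e] at this
  have hpt : ∀ y, ENNReal.ofReal (Real.exp (θ / (v * R) * ∑ k, (y ⬝ᵥ a k) ^ 2)) ≤
      ∑ o, ENNReal.ofReal (p o) * ENNReal.ofReal (Real.exp (Y o y)) := by
    intro y
    have hj := convexOn_exp.map_sum_le (t := Finset.univ) (w := p) (p := fun o => Y o y)
      (fun o _ => hp0 o) hp1 (fun _ _ => Set.mem_univ _)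
    simp only [smul_eq_mul] at hj
    have e : ∑ o, p o * Y o y = θ / (v * R) * ∑ k, (y ⬝ᵥ a k) ^ 2 := by
      rw [Fintype.sum_option, Finset.mul_sum]
      simp only [hp, hY, Option.elim, mul_zero, zero_add]
      refine Finset.sum_congr rfl fun k _ => ?_
      by_cases hk : q k = 0
      · have : a k = 0 := dotProduct_self_eq_zero.1 hk
        simp [this]
      · simp only [hc]; field_simp
    rw [e] at hj
    refine (ENNReal.ofReal_le_ofReal hj).trans (le_of_eq ?_)
    rw [ENNReal.ofReal_sum_of_nonneg (fun o _ => mul_nonneg (hp0 o) (Real.exp_pos _).le)]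
    exact Finset.sum_congr rfl fun o _ => ENNReal.ofReal_mul (hp0 o)
  refine (lintegral_mono hpt).trans ?_
  rw [lintegral_finsetSum _ (fun o _ => by have := hYm o; fun_prop)]
  calc _ ≤ ∑ o, ENNReal.ofReal (p o) * ENNReal.ofReal (Real.exp (θ + 2 * θ ^ 2)) := by
        refine Finset.sum_le_sum fun o _ => ?_
        rw [lintegral_const_mul _ (by have := hYm o; fun_prop)]
        gcongr
        exact hYint o
    _ = _ := by
        rw [← Finset.sum_mul, ← ENNReal.ofReal_sum_of_nonneg (fun o _ => hp0 o), hp1]; simp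

/-- squared Frobenius norm of `∑ u_i v_i^T` -/
def frob {d n : ℕ} (U V : Fin n → Fin d → ℝ) : ℝ :=
  ∑ l, ∑ k, (∑ i, V i l * U i k) ^ 2

lemma frob_exp (d n : ℕ) (hd : 0 < d) (U : Fin n → Fin d → ℝ) (R θ : ℝ)
    (hR : ∑ i, U i ⬝ᵥ U i ≤ R) (hR0 : 0 < R) (h0 : 0 ≤ θ) (h1 : θ ≤ 1/4) :
    ∫⁻ V, ENNReal.ofReal (Real.exp (θ * d / R * frob U V)) ∂(gm d n)
      ≤ ENNReal.ofReal (Real.exp (d * (θ + 2 * θ ^ 2))) := by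
  have hd' : (0:ℝ) < d := by exact_mod_cast hd
  set v : NNReal := (d : NNReal)⁻¹ with hv
  have hv0 : 0 < v := by positivity
  set f : (Fin n → ℝ) → ENNReal := fun y =>
    ENNReal.ofReal (Real.exp (θ / (v * R) * ∑ k, (y ⬝ᵥ (fun i => U i k)) ^ 2)) with hf
  have hfm : Measurable f := by fun_prop
  have hR' : ∑ k, (fun i => U i k) ⬝ᵥ (fun i => U i k) ≤ R := by
    refine le_trans (le_of_eq ?_) hR
    unfold dotProduct
    rw [Finset.sum_comm]
  have h2 := lintegral_pi_prod_le' (fun _ : Fin d => Measure.pi fun _ : Fin n => gaussianReal 0 v)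
    (fun _ => f) (fun _ => hfm) _ (fun _ => jensen_vec v hv0 (fun k i => U i k) R θ hR' hR0 h0 h1)
  rw [← pi_transpose, lintegral_map (by fun_prop) (by fun_prop), ← exp_sum_prod] at h2
  simp only [Finset.sum_const, Finset.card_univ, Fintype.card_fin, nsmul_eq_mul] at h2
  refine le_trans (le_of_eq ?_) h2
  refine lintegral_congr fun V => ?_
  simp only [hf]
  rw [← exp_sum_prod, ← Finset.mul_sum]
  have : θ * d / R = θ / (v * R) := by rw [hv]; push_cast; field_simp
  rw [this]
  rfl

lemma frob_probA (d n : ℕ) (hd : 0 < d) (hn : 0 < n) (ε : ℝ) (h0 : 0 < ε) (h1 : ε ≤ 1) (R : ℝ) (hR : R = (1 + ε) * n) :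
    gm d n {U | R ≤ ∑ i, U i ⬝ᵥ U i} ≤ ENNReal.ofReal (Real.exp (- (d * ε ^ 2 / 8))) := by
  classical
  have hd' : (0:ℝ) < d := by exact_mod_cast hd
  have hn' : (1:ℝ) ≤ n := by exact_mod_cast hn
  have e : ε / 4 * d * ((d : NNReal)⁻¹ : NNReal) = ε / 4 := by push_cast; field_simp
  have hv := vec_exp_norm (ι := Fin d) (d : NNReal)⁻¹ (ε / 4 * d)
    (by rw [e, abs_of_pos (by positivity)]; linarith)
  rw [e, Fintype.card_fin] at hv
  have h2 := lintegral_pi_prod_le' (fun _ : Fin n => stdGaussianVec d)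
    (fun _ y => ENNReal.ofReal (Real.exp (ε / 4 * d * (y ⬝ᵥ y)))) (fun _ => by fun_prop) _
    (fun _ => hv)
  rw [← exp_sum_prod] at h2
  simp only [Finset.sum_const, Finset.card_univ, Fintype.card_fin, nsmul_eq_mul,
    ← exp_sum_prod] at h2
  have h3 := chernoff (gm d n) (fun U => ∑ i, ε / 4 * d * (U i ⬝ᵥ U i)) (by fun_prop)
    (ε / 4 * d * R) _ h2
  refine le_trans (measure_mono ?_) (h3.trans (ENNReal.ofReal_le_ofReal (Real.exp_le_exp.2 ?_)))
  · intro U hU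
    simp only [Set.mem_ofPred_eq, ← Finset.mul_sum] at hU ⊢
    gcongr
  · have : (n:ℝ) * (d * (ε / 4 + 2 * (ε / 4) ^ 2)) - ε / 4 * d * R = - (n * (d * ε ^ 2 / 8)) := by
      rw [hR]; ring
    rw [this, neg_le_neg_iff]
    have : 0 ≤ d * ε ^ 2 / 8 := by positivity
    nlinarith

lemma frob_probB (d n : ℕ) (hd : 0 < d) (hn : 0 < n) (ε : ℝ) (h0 : 0 < ε) (h1 : ε ≤ 1) (R : ℝ) (hR0 : 0 < R) :
    gaussianModel d n {p | ∑ i, p.1 i ⬝ᵥ p.1 i ≤ R ∧ (1 + ε) * R ≤ frob p.1 p.2} ≤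
      ENNReal.ofReal (Real.exp (- (d * ε ^ 2 / 8))) := by
  classical
  have hd' : (0:ℝ) < d := by exact_mod_cast hd
  have hn' : (1:ℝ) ≤ n := by exact_mod_cast hn
  set f : (Fin n → Fin d → ℝ) × (Fin n → Fin d → ℝ) → ℝ := fun p =>
    if ∑ i, p.1 i ⬝ᵥ p.1 i ≤ R then ε / 4 * d / R * frob p.1 p.2 else 0 with hf
  have hfm : Measurable f := by
    refine Measurable.ite (measurableSet_le (by fun_prop) (by fun_prop)) ?_ (by fun_prop)
    unfold frob
    fun_prop
  have h2 : ∫⁻ p, ENNReal.ofReal (Real.exp (f p)) ∂(gaussianModel d n) ≤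
      ENNReal.ofReal (Real.exp (d * (ε / 4 + 2 * (ε / 4) ^ 2))) := by
    rw [gaussianModel_eq, lintegral_prod _ (by fun_prop)]
    calc _ ≤ ∫⁻ U, ENNReal.ofReal (Real.exp (d * (ε / 4 + 2 * (ε / 4) ^ 2))) ∂(gm d n) := by
          refine lintegral_mono fun U => ?_
          by_cases hU : ∑ i, U i ⬝ᵥ U i ≤ R
          · simp only [hf, hU, if_true]
            exact frob_exp d n hd U R (ε / 4) hU hR0 (by positivity) (by linarith)
          · simp only [hf, hU, if_false]
            simp only [Real.exp_zero, ENNReal.ofReal_one, lintegral_const, measure_univ, mul_one]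
            rw [← ENNReal.ofReal_one]
            exact ENNReal.ofReal_le_ofReal (Real.one_le_exp (by positivity))
      _ = _ := by simp
  have h3 := chernoff _ f hfm (ε / 4 * d / R * ((1 + ε) * R)) _ h2
  refine le_trans (measure_mono ?_) (h3.trans (ENNReal.ofReal_le_ofReal (Real.exp_le_exp.2 ?_)))
  · rintro p ⟨hp1, hp2⟩
    simp only [Set.mem_ofPred_eq, hf, hp1, if_true]
    gcongr
  · have : ε / 4 * d / R * ((1 + ε) * R) = ε / 4 * d * (1 + ε) := by field_simp
    rw [this]; nlinarith

lemma frob_prob (d n : ℕ) (hd : 0 < d) (hn : 0 < n) (ε : ℝ) (h0 : 0 < ε) (h1 : ε ≤ 1) :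
    gaussianModel d n {p | (1 + ε) ^ 2 * n ≤ frob p.1 p.2} ≤
      ENNReal.ofReal (2 * Real.exp (- (d * ε ^ 2 / 8))) := by
  classical
  have hd' : (0:ℝ) < d := by exact_mod_cast hd
  have hn' : (1:ℝ) ≤ n := by exact_mod_cast hn
  set R : ℝ := (1 + ε) * n with hR
  have hR0 : 0 < R := by positivity
  have hA := frob_probA d n hd hn ε h0 h1 R hR
  have hB := frob_probB d n hd hn ε h0 h1 R hR0
  rw [two_mul, ENNReal.ofReal_add (by positivity) (by positivity)]
  refine le_trans (measure_mono (t := {p | p.1 ∈ {U : Fin n → Fin d → ℝ | R ≤ ∑ i, U i ⬝ᵥ U i}} ∪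
    {p | ∑ i, p.1 i ⬝ᵥ p.1 i ≤ R ∧ (1 + ε) * R ≤ frob p.1 p.2}) ?_)
    ((measure_union_le _ _).trans (add_le_add (by rw [gmodel_fst]; exact hA) hB))
  intro p hp
  rcases le_total R (∑ i, p.1 i ⬝ᵥ p.1 i) with h | h
  · exact Or.inl h
  · refine Or.inr ⟨h, ?_⟩
    have : (1 + ε) * R = (1 + ε) ^ 2 * n := by rw [hR]; ring
    rw [this]; exact hp

lemma det_bound {d n : ℕ} (hn : 2 ≤ n) (U V : Fin n → Fin d → ℝ) (τ κ : ℝ) (hτ : 0 ≤ τ)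
    (h2 : ∀ x : Fin d → ℝ, ∃ j, τ * √(x ⬝ᵥ x) ≤ U j ⬝ᵥ x)
    (h3 : ∀ a : Fin d → ℝ, κ * n * √(a ⬝ᵥ a) ≤ ∑ i, |a ⬝ᵥ V i|)
    (hp : (U, V) ∈ PRset d n) : τ * κ * n ≤ √(frob U V) := by
  obtain ⟨W, hW⟩ := hp
  simp only [score] at hW
  set M2 : ℝ := ∑ k, W k ⬝ᵥ W k with hM2
  have hM20 : 0 ≤ M2 := Finset.sum_nonneg fun k _ => dot_self_nonneg' _
  have hMpos : 0 < M2 := by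
    refine lt_of_le_of_ne hM20 fun h => ?_
    have hz := (Finset.sum_eq_zero_iff_of_nonneg (fun k _ => dot_self_nonneg' (W k))).1 h.symm
    have hW0 : W = 0 := by
      ext k l
      have : W k = 0 := dotProduct_self_eq_zero.1 (hz k (Finset.mem_univ _))
      rw [this]; rfl
    have := hW ⟨0, by omega⟩ ⟨1, by omega⟩ (by simp)
    simp [hW0] at this
  have hA : ∀ i, τ * √(W.mulVec (V i) ⬝ᵥ W.mulVec (V i)) ≤ U i ⬝ᵥ W.mulVec (V i) := by
    intro i
    obtain ⟨j, hj⟩ := h2 (W.mulVec (V i))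
    refine hj.trans ?_
    by_cases hij : j = i
    · rw [hij]
    · exact (hW i j hij).le
  have hB : ∑ i, U i ⬝ᵥ W.mulVec (V i) ≤ √M2 * √(frob U V) := by
    have h := Real.sum_mul_le_sqrt_mul_sqrt Finset.univ (fun q : Fin d × Fin d => W q.2 q.1)
      (fun q => ∑ i, V i q.1 * U i q.2)
    have e1 : ∑ q : Fin d × Fin d, (W q.2 q.1) ^ 2 = M2 := by
      rw [Fintype.sum_prod_type_right, hM2]
      refine Finset.sum_congr rfl fun k _ => Finset.sum_congr rfl fun l _ => by ring
    have e2 : ∑ q : Fin d × Fin d, (∑ i, V i q.1 * U i q.2) ^ 2 = frob U V := by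
      rw [Fintype.sum_prod_type]; rfl
    rw [e1, e2] at h
    refine le_trans (le_of_eq ?_) h
    simp only [Finset.mul_sum]
    rw [Finset.sum_comm]
    refine Finset.sum_congr rfl fun i _ => ?_
    rw [Fintype.sum_prod_type_right]
    simp only [dotProduct, Matrix.mulVec, Finset.mul_sum]
    refine Finset.sum_congr rfl fun k _ => Finset.sum_congr rfl fun l _ => by ring
  have hC : ∀ i, ∑ k, √(W k ⬝ᵥ W k) * |W k ⬝ᵥ V i| ≤
      √M2 * √(W.mulVec (V i) ⬝ᵥ W.mulVec (V i)) := by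
    intro i
    have h := Real.sum_mul_le_sqrt_mul_sqrt Finset.univ (fun k => √(W k ⬝ᵥ W k))
      (fun k => |W k ⬝ᵥ V i|)
    simp only [Real.sq_sqrt (dot_self_nonneg' _), sq_abs] at h
    refine h.trans (le_of_eq ?_)
    congr 2
    refine Finset.sum_congr rfl fun k _ => ?_
    simp only [Matrix.mulVec]; ring
  have hD : κ * n * M2 ≤ √M2 * ∑ i, √(W.mulVec (V i) ⬝ᵥ W.mulVec (V i)) := by
    rw [Finset.mul_sum _ _ (√M2)]
    refine le_trans ?_ (Finset.sum_le_sum fun i _ => hC i)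
    rw [Finset.sum_comm, hM2, Finset.mul_sum]
    refine Finset.sum_le_sum fun k _ => ?_
    rw [← Finset.mul_sum]
    have := mul_le_mul_of_nonneg_left (h3 (W k)) (Real.sqrt_nonneg (W k ⬝ᵥ W k))
    refine le_trans (le_of_eq ?_) this
    have e := Real.mul_self_sqrt (dot_self_nonneg' (W k))
    linear_combination (-(κ * n)) * e
  have hE : τ * ∑ i, √(W.mulVec (V i) ⬝ᵥ W.mulVec (V i)) ≤ √M2 * √(frob U V) := by
    rw [Finset.mul_sum]
    exact (Finset.sum_le_sum fun i _ => hA i).trans hB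
  have hs := Real.mul_self_sqrt hM20
  have h5 : τ * (κ * n * M2) ≤ M2 * √(frob U V) := by
    calc _ ≤ τ * (√M2 * ∑ i, √(W.mulVec (V i) ⬝ᵥ W.mulVec (V i))) :=
          mul_le_mul_of_nonneg_left hD hτ
      _ = √M2 * (τ * ∑ i, √(W.mulVec (V i) ⬝ᵥ W.mulVec (V i))) := by ring
      _ ≤ √M2 * (√M2 * √(frob U V)) := mul_le_mul_of_nonneg_left hE (Real.sqrt_nonneg _)
      _ = _ := by rw [← mul_assoc, hs]
  have : M2 * (τ * κ * n) ≤ M2 * √(frob U V) := by linarith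
  exact le_of_mul_le_mul_left this hMpos

/-- grid point -/
def grid {d : ℕ} (K : ℕ) (b : Fin d → Fin (2 * K + 1)) : Fin d → ℝ :=
  fun k => (((b k : ℕ) : ℝ) - K) / K

lemma round_coord (K : ℕ) (hK : 0 < K) (x : ℝ) (hx : |x| ≤ 1) :
    ∃ z : Fin (2 * K + 1), |x - (((z : ℕ) : ℝ) - K) / K| ≤ 1 / K ∧
      x ^ 2 ≤ ((((z : ℕ) : ℝ) - K) / K) ^ 2 := by
  have hK' : (0:ℝ) < K := by exact_mod_cast hK
  obtain ⟨m, hmK, hm1, hm2⟩ : ∃ m : ℕ, m ≤ K ∧ |x| * K ≤ m ∧ (m:ℝ) ≤ |x| * K + 1 := by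
    refine ⟨⌈|x| * K⌉₊, ?_, Nat.le_ceil _, (Nat.ceil_lt_add_one (by positivity)).le⟩
    rw [Nat.ceil_le]; nlinarith
  have h1 : |x| ≤ m / K := by rw [le_div_iff₀ hK']; exact hm1
  have h2 : (m:ℝ) / K ≤ |x| + 1 / K := by
    rw [div_le_iff₀ hK', add_mul, one_div_mul_cancel hK'.ne']; exact hm2
  have hsq : x ^ 2 ≤ ((m:ℝ) / K) ^ 2 := by
    rw [← sq_abs]; gcongr
  rcases le_total 0 x with h | h
  · refine ⟨⟨K + m, by omega⟩, ?_⟩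
    have e : (((K + m : ℕ) : ℝ) - K) / K = m / K := by push_cast; ring
    simp only [e]
    rw [abs_of_nonneg h] at h1 h2
    refine ⟨?_, hsq⟩
    rw [abs_sub_le_iff]; constructor
    · have : 0 ≤ 1 / (K:ℝ) := by positivity
      linarith
    · linarith
  · refine ⟨⟨K - m, by omega⟩, ?_⟩
    have e : (((K - m : ℕ) : ℝ) - K) / K = - (m / K) := by
      rw [Nat.cast_sub hmK]; ring
    simp only [e]
    rw [abs_of_nonpos h] at h1 h2
    refine ⟨?_, by rw [neg_sq]; exact hsq⟩
    rw [abs_sub_le_iff]; constructor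
    · linarith
    · have : 0 ≤ 1 / (K:ℝ) := by positivity
      linarith

lemma round_vec {d : ℕ} (K : ℕ) (hK : 0 < K) (a : Fin d → ℝ) (ha : a ⬝ᵥ a = 1) :
    ∃ b : Fin d → Fin (2 * K + 1), (∀ k, |a k - grid K b k| ≤ 1 / K) ∧
      1 ≤ grid K b ⬝ᵥ grid K b := by
  have hc : ∀ k, |a k| ≤ 1 := by
    intro k
    rw [← sq_le_one_iff_abs_le_one, ← ha, sq]
    exact Finset.single_le_sum (f := fun k => a k * a k) (fun i _ => mul_self_nonneg _)
      (Finset.mem_univ k)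
  choose b hb1 hb2 using fun k => round_coord K hK (a k) (hc k)
  refine ⟨b, hb1, ?_⟩
  rw [← ha]
  refine Finset.sum_le_sum fun k _ => ?_
  have := hb2 k
  simp only [grid]
  nlinarith

lemma round_err {d n : ℕ} (hn : 0 < n) (hdn : d ≤ n) (a : Fin d → ℝ)
    (b : Fin d → Fin (2 * (n ^ 3) + 1)) (h : ∀ k, |a k - grid (n ^ 3) b k| ≤ 1 / ((n ^ 3 : ℕ) : ℝ))
    (u : Fin d → ℝ) (hu : u ⬝ᵥ u ≤ n) : |a ⬝ᵥ u - grid (n ^ 3) b ⬝ᵥ u| ≤ 1 / n := by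
  have hn' : (1:ℝ) ≤ n := by exact_mod_cast hn
  have hdn' : (d:ℝ) ≤ n := by exact_mod_cast hdn
  have hc : ∀ k, |u k| ≤ n := by
    intro k
    refine abs_le_of_sq_le_sq (le_trans ?_ (show (n:ℝ) ≤ n ^ 2 by nlinarith)) (by positivity)
    refine le_trans ?_ hu
    rw [sq]
    exact Finset.single_le_sum (f := fun k => u k * u k) (fun i _ => mul_self_nonneg _)
      (Finset.mem_univ k)
  rw [← sub_dotProduct]
  refine (Finset.abs_sum_le_sum_abs _ _).trans ?_
  calc _ ≤ ∑ k : Fin d, 1 / ((n ^ 3 : ℕ) : ℝ) * n := by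
        refine Finset.sum_le_sum fun k _ => ?_
        rw [abs_mul]
        exact mul_le_mul (h k) (hc k) (abs_nonneg _) (by positivity)
    _ = d * (1 / ((n ^ 3 : ℕ) : ℝ) * n) := by simp
    _ ≤ n * (1 / ((n ^ 3 : ℕ) : ℝ) * n) := by gcongr
    _ = 1 / n := by push_cast; field_simp

lemma netE2 {d n : ℕ} (hn : 0 < n) (hdn : d ≤ n) (τ : ℝ) (U : Fin n → Fin d → ℝ)
    (hU : ∀ j, U j ⬝ᵥ U j ≤ n) (x : Fin d → ℝ) (hx : ∀ j, U j ⬝ᵥ x < τ * √(x ⬝ᵥ x)) :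
    ∃ b : Fin d → Fin (2 * (n ^ 3) + 1), 1 ≤ grid (n ^ 3) b ⬝ᵥ grid (n ^ 3) b ∧
      ∀ j, U j ⬝ᵥ grid (n ^ 3) b ≤ τ + 1 / n := by
  have hx0 : 0 < x ⬝ᵥ x := by
    refine lt_of_le_of_ne (dot_self_nonneg' _) fun h => ?_
    have h0 : x = 0 := dotProduct_self_eq_zero.1 h.symm
    have := hx ⟨0, hn⟩
    simp [h0] at this
  set s := √(x ⬝ᵥ x) with hs
  have hs0 : 0 < s := Real.sqrt_pos.2 hx0
  have hss : s * s = x ⬝ᵥ x := Real.mul_self_sqrt hx0.le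
  have ha : (s⁻¹ • x) ⬝ᵥ (s⁻¹ • x) = 1 := by
    rw [smul_dotProduct, dotProduct_smul, ← hss]; simp only [smul_eq_mul]; field_simp
  obtain ⟨b, hb1, hb2⟩ := round_vec (n ^ 3) (by positivity) (s⁻¹ • x) ha
  refine ⟨b, hb2, fun j => ?_⟩
  have h1 := round_err hn hdn _ b hb1 (U j) (hU j)
  have h2 : (s⁻¹ • x) ⬝ᵥ U j < τ := by
    rw [smul_dotProduct, dotProduct_comm, smul_eq_mul, inv_mul_lt_iff₀ hs0, mul_comm]; exact hx j
  rw [dotProduct_comm (U j)]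
  have := (abs_sub_le_iff.1 h1).2
  linarith

lemma netE3 {d n : ℕ} (hn : 0 < n) (hdn : d ≤ n) (κ : ℝ) (V : Fin n → Fin d → ℝ)
    (hV : ∀ j, V j ⬝ᵥ V j ≤ n) (x : Fin d → ℝ) (hx : ∑ i, |x ⬝ᵥ V i| < κ * n * √(x ⬝ᵥ x)) :
    ∃ b : Fin d → Fin (2 * (n ^ 3) + 1), 1 ≤ grid (n ^ 3) b ⬝ᵥ grid (n ^ 3) b ∧
      ∑ i, |V i ⬝ᵥ grid (n ^ 3) b| ≤ n * (κ + 1 / n) := by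
  have hx0 : 0 < x ⬝ᵥ x := by
    refine lt_of_le_of_ne (dot_self_nonneg' _) fun h => ?_
    have h0 : x = 0 := dotProduct_self_eq_zero.1 h.symm
    simp [h0] at hx
  set s := √(x ⬝ᵥ x) with hs
  have hs0 : 0 < s := Real.sqrt_pos.2 hx0
  have hss : s * s = x ⬝ᵥ x := Real.mul_self_sqrt hx0.le
  have ha : (s⁻¹ • x) ⬝ᵥ (s⁻¹ • x) = 1 := by
    rw [smul_dotProduct, dotProduct_smul, ← hss]; simp only [smul_eq_mul]; field_simp
  obtain ⟨b, hb1, hb2⟩ := round_vec (n ^ 3) (by positivity) (s⁻¹ • x) ha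
  refine ⟨b, hb2, ?_⟩
  have h1 : ∀ i, |V i ⬝ᵥ grid (n ^ 3) b| ≤ |(s⁻¹ • x) ⬝ᵥ V i| + 1 / n := by
    intro i
    have h1 := round_err hn hdn _ b hb1 (V i) (hV i)
    rw [dotProduct_comm (V i)]
    have h2 := abs_sub_abs_le_abs_sub (grid (n ^ 3) b ⬝ᵥ V i) ((s⁻¹ • x) ⬝ᵥ V i)
    rw [abs_sub_comm] at h2
    linarith
  have h2 : ∑ i, |(s⁻¹ • x) ⬝ᵥ V i| ≤ κ * n := by
    simp only [smul_dotProduct, smul_eq_mul, abs_mul, abs_of_pos (inv_pos.2 hs0)]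
    rw [← Finset.mul_sum, inv_mul_le_iff₀ hs0, mul_comm]; exact hx.le
  refine (Finset.sum_le_sum fun i _ => h1 i).trans ?_
  rw [Finset.sum_add_distrib]
  simp only [Finset.sum_const, Finset.card_univ, Fintype.card_fin, nsmul_eq_mul]
  linarith

lemma gauss_abs : ∫ x, |x| ∂(gaussianReal 0 1) = √(2 / Real.pi) := by
  rw [integral_gaussianReal_eq_integral_smul (by norm_num)]
  have h1 : ∀ x : ℝ, gaussianPDFReal 0 1 x • |x| =
      (fun y => (√(2 * Real.pi))⁻¹ * (y * Real.exp (-(1/2) * y ^ 2))) |x| := by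
    intro x
    simp only [gaussianPDFReal, smul_eq_mul, sq_abs, NNReal.coe_one, sub_zero, mul_one]
    rw [show -x ^ 2 / 2 = -(1/2) * x ^ 2 by ring]; ring
  simp_rw [h1]
  rw [integral_comp_abs (f := fun y => (√(2 * Real.pi))⁻¹ * (y * Real.exp (-(1/2) * y ^ 2))),
    integral_const_mul]
  have h2 := integral_rpow_mul_exp_neg_mul_rpow (p := 2) (q := 1) (b := 1/2) (by norm_num)
    (by norm_num) (by norm_num)
  have h3 : ∫ x in Set.Ioi (0:ℝ), x * Real.exp (-(1/2) * x ^ 2) = 1 := by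
    rw [show ((1:ℝ) + 1) / 2 = 1 by norm_num, show (-((1:ℝ) + 1) / 2) = -1 by norm_num,
      Real.Gamma_one, Real.rpow_neg_one] at h2
    norm_num at h2 ⊢
    exact h2
  rw [h3, mul_one, Real.sqrt_div (by norm_num), Real.sqrt_mul (by norm_num)]
  have : √2 * √2 = 2 := Real.mul_self_sqrt (by norm_num)
  have hp : 0 < √Real.pi := Real.sqrt_pos.2 Real.pi_pos
  field_simp
  linarith

lemma exp_neg_le {x : ℝ} (hx : 0 ≤ x) : Real.exp (-x) ≤ 1 - x + x ^ 2 / 2 := by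
  have h := Real.quadratic_le_exp_of_nonneg hx
  have h0 := Real.exp_pos x
  rw [Real.exp_neg, inv_le_iff_one_le_mul₀ h0]
  have h1 : 0 ≤ 1 - x + x ^ 2 / 2 := by nlinarith [sq_nonneg (x - 1)]
  have := mul_le_mul_of_nonneg_left h h1
  nlinarith [sq_nonneg (x ^ 2)]

lemma gauss_exp_abs (l : ℝ) (hl : 0 ≤ l) :
    ∫⁻ x, ENNReal.ofReal (Real.exp (- (l * |x|))) ∂(gaussianReal 0 1) ≤
      ENNReal.ofReal (Real.exp (- (l * √(2 / Real.pi)) + l ^ 2 / 2)) := by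
  have hi1 : Integrable (fun x : ℝ => x) (gaussianReal 0 1) :=
    (memLp_id_gaussianReal (μ := 0) (v := 1) 1).integrable (by simp)
  have hi2 : Integrable (fun x : ℝ => x ^ 2) (gaussianReal 0 1) :=
    (memLp_id_gaussianReal (μ := 0) (v := 1) 2).integrable_sq
  have hi : Integrable (fun x : ℝ => 1 - l * |x| + (l * |x|) ^ 2 / 2) (gaussianReal 0 1) := by
    refine ((integrable_const _).sub (hi1.abs.const_mul l)).add ?_
    simp only [mul_pow, sq_abs]
    exact (hi2.const_mul _).div_const _
  have hv : ∫ x, x ^ 2 ∂(gaussianReal 0 1) = 1 := by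
    have h := variance_fun_id_gaussianReal (μ := 0) (v := 1)
    rw [variance_of_integral_eq_zero (by fun_prop) integral_id_gaussianReal] at h
    simpa using h
  have hval : ∫ x, (1 - l * |x| + (l * |x|) ^ 2 / 2) ∂(gaussianReal 0 1) =
      1 - l * √(2 / Real.pi) + l ^ 2 / 2 := by
    have i3 : Integrable (fun x : ℝ => 1 - l * |x|) (gaussianReal 0 1) :=
      (integrable_const _).sub (hi1.abs.const_mul l)
    have i4 : Integrable (fun x : ℝ => (l * |x|) ^ 2 / 2) (gaussianReal 0 1) := by
      simp only [mul_pow, sq_abs]; exact (hi2.const_mul _).div_const _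
    rw [integral_add i3 i4, integral_sub (integrable_const _) (hi1.abs.const_mul l), integral_const_mul, gauss_abs]
    simp only [mul_pow, sq_abs]
    rw [integral_div, integral_const_mul, hv]; simp
  calc _ ≤ ∫⁻ x, ENNReal.ofReal (1 - l * |x| + (l * |x|) ^ 2 / 2) ∂(gaussianReal 0 1) := by
        refine lintegral_mono fun x => ENNReal.ofReal_le_ofReal (exp_neg_le (by positivity))
    _ = ENNReal.ofReal (1 - l * √(2 / Real.pi) + l ^ 2 / 2) := by
        rw [← ofReal_integral_eq_lintegral_ofReal hi
          (Eventually.of_forall fun x => (Real.exp_pos _).le.trans (exp_neg_le (by positivity))),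
          hval]
    _ ≤ _ := by
        refine ENNReal.ofReal_le_ofReal ?_
        have := Real.add_one_le_exp (- (l * √(2 / Real.pi)) + l ^ 2 / 2)
        linarith

lemma gauss_tail (t : ℝ) (ht : 0 ≤ t) :
    ENNReal.ofReal ((√(2 * Real.pi))⁻¹ * Real.exp (- ((t + 1) ^ 2 / 2))) ≤
      gaussianReal 0 1 (Set.Ioi t) := by
  rw [gaussianReal_apply _ (by norm_num)]
  calc _ = ∫⁻ _ in Set.Ioc t (t + 1),
        ENNReal.ofReal ((√(2 * Real.pi))⁻¹ * Real.exp (- ((t + 1) ^ 2 / 2))) := by simp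
    _ ≤ ∫⁻ x in Set.Ioc t (t + 1), gaussianPDF 0 1 x := by
        refine setLIntegral_mono (by fun_prop) fun x hx => ?_
        rw [gaussianPDF]
        refine ENNReal.ofReal_le_ofReal ?_
        simp only [gaussianPDFReal, NNReal.coe_one, mul_one, sub_zero]
        refine mul_le_mul_of_nonneg_left (Real.exp_le_exp.2 ?_) (by positivity)
        have : x ^ 2 ≤ (t + 1) ^ 2 := pow_le_pow_left₀ (ht.trans hx.1.le) hx.2 2
        linarith
    _ ≤ _ := lintegral_mono_set Set.Ioc_subset_Ioi_self

lemma vec_dot_map (d : ℕ) (g : Fin d → ℝ) :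
    (stdGaussianVec d).map (fun u => u ⬝ᵥ g) =
      (gaussianReal 0 1).map (fun t => √(g ⬝ᵥ g / d) * t) := by
  rw [gaussianReal_map_const_mul, stdGaussianVec, map_dot]
  congr 1
  · simp
  · ext
    have h := dot_self_nonneg' g
    simp only [NNReal.coe_mul, NNReal.coe_mk, mul_one, NNReal.coe_inv, NNReal.coe_natCast,
      Real.coe_toNNReal _ h]
    rw [Real.sq_sqrt (by positivity)]; ring

lemma vec_le_prob (d : ℕ) (hd : 0 < d) (g : Fin d → ℝ) (hg : 1 ≤ g ⬝ᵥ g) (s : ℝ) (hs : 0 ≤ s) :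
    stdGaussianVec d {u | u ⬝ᵥ g ≤ s} ≤ ENNReal.ofReal (Real.exp (-
      ((√(2 * Real.pi))⁻¹ * Real.exp (- ((s * √d + 1) ^ 2 / 2))))) := by
  have hd' : (0:ℝ) < d := by exact_mod_cast hd
  set q := (√(2 * Real.pi))⁻¹ * Real.exp (- ((s * √d + 1) ^ 2 / 2)) with hq
  have hsd : 0 < √(d:ℝ) := Real.sqrt_pos.2 hd'
  have h1 : stdGaussianVec d {u | u ⬝ᵥ g ≤ s} = (gaussianReal 0 1)
      {t | √(g ⬝ᵥ g / d) * t ≤ s} := by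
    have := congrArg (fun μ => μ (Set.Iic s)) (vec_dot_map d g)
    rwa [Measure.map_apply (by fun_prop) measurableSet_Iic,
      Measure.map_apply (by fun_prop) measurableSet_Iic] at this
  rw [h1]
  have h2 : {t : ℝ | √(g ⬝ᵥ g / d) * t ≤ s} ⊆ (Set.Ioi (s * √d))ᶜ := by
    intro t ht
    simp only [Set.mem_ofPred_eq, Set.mem_compl_iff, Set.mem_Ioi, not_lt] at ht ⊢
    by_contra hc
    push Not at hc
    have ht0 : 0 < t := lt_of_le_of_lt (by positivity) hc
    have h3 : 1 / √d ≤ √(g ⬝ᵥ g / d) := by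
      rw [Real.sqrt_div (by linarith)]
      gcongr
      rw [Real.one_le_sqrt]; exact hg
    have h4 : s < 1 / √d * t := by
      rw [one_div, lt_inv_mul_iff₀ hsd, mul_comm]; exact hc
    have := mul_le_mul_of_nonneg_right h3 ht0.le
    linarith
  refine (measure_mono h2).trans ?_
  rw [prob_compl_eq_one_sub measurableSet_Ioi]
  refine (tsub_le_tsub_left (gauss_tail (s * √d) (by positivity)) 1).trans ?_
  rw [← ENNReal.ofReal_one, ← ENNReal.ofReal_sub _ (by positivity)]
  refine ENNReal.ofReal_le_ofReal ?_
  have := Real.add_one_le_exp (-q)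
  linarith

lemma gm_le_prob (d n : ℕ) (hd : 0 < d) (g : Fin d → ℝ) (hg : 1 ≤ g ⬝ᵥ g) (s : ℝ) (hs : 0 ≤ s) :
    gm d n {U | ∀ j, U j ⬝ᵥ g ≤ s} ≤ ENNReal.ofReal (Real.exp (- (n *
      ((√(2 * Real.pi))⁻¹ * Real.exp (- ((s * √d + 1) ^ 2 / 2)))))) := by
  have e : {U : Fin n → Fin d → ℝ | ∀ j, U j ⬝ᵥ g ≤ s} =
      Set.pi Set.univ (fun _ => {u | u ⬝ᵥ g ≤ s}) := by
    ext U; simp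
  rw [e, gm, Measure.pi_pi]
  simp only [Finset.prod_const, Finset.card_univ, Fintype.card_fin]
  refine (pow_le_pow_left₀ (by simp) (vec_le_prob d hd g hg s hs) n).trans (le_of_eq ?_)
  rw [← ENNReal.ofReal_pow (Real.exp_pos _).le, ← Real.exp_nat_mul]
  congr 2; ring

lemma vec_exp_abs (d : ℕ) (hd : 0 < d) (g : Fin d → ℝ) (hg : 1 ≤ g ⬝ᵥ g) (l : ℝ) (hl : 0 ≤ l) :
    ∫⁻ u, ENNReal.ofReal (Real.exp (- (l * √d * |u ⬝ᵥ g|))) ∂(stdGaussianVec d) ≤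
      ENNReal.ofReal (Real.exp (- (l * √(2 / Real.pi)) + l ^ 2 / 2)) := by
  have hd' : (0:ℝ) < d := by exact_mod_cast hd
  have hsd : 0 < √(d:ℝ) := Real.sqrt_pos.2 hd'
  have hm : Measurable (fun t : ℝ => ENNReal.ofReal (Real.exp (- (l * √d * |t|)))) := by fun_prop
  rw [← lintegral_map (f := fun t : ℝ => ENNReal.ofReal (Real.exp (- (l * √d * |t|)))) hm
    (g := fun u => u ⬝ᵥ g) (by fun_prop), vec_dot_map, lintegral_map hm (by fun_prop)]
  refine le_trans (lintegral_mono fun t => ?_) (gauss_exp_abs l hl)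
  refine ENNReal.ofReal_le_ofReal (Real.exp_le_exp.2 (neg_le_neg ?_))
  rw [abs_mul, abs_of_nonneg (Real.sqrt_nonneg _), mul_assoc]
  refine mul_le_mul_of_nonneg_left ?_ hl
  rw [← mul_assoc, ← Real.sqrt_mul hd'.le]
  have : 1 ≤ √(d * (g ⬝ᵥ g / d)) := by
    rw [Real.one_le_sqrt]; field_simp; exact hg
  nlinarith [abs_nonneg t]

lemma gm_abs_prob (d n : ℕ) (hd : 0 < d) (g : Fin d → ℝ) (hg : 1 ≤ g ⬝ᵥ g) (ε : ℝ) (h0 : 0 ≤ ε)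
    (s : ℝ) (hs : s * √d ≤ √(2 / Real.pi) - ε) :
    gm d n {V | ∑ i, |V i ⬝ᵥ g| ≤ n * s} ≤ ENNReal.ofReal (Real.exp (- (n * (ε ^ 2 / 2)))) := by
  have h2 := lintegral_pi_prod_le' (fun _ : Fin n => stdGaussianVec d)
      (fun _ y => ENNReal.ofReal (Real.exp (- (ε * √d * |y ⬝ᵥ g|)))) (fun _ => by fun_prop) _
      (fun _ => vec_exp_abs d hd g hg ε h0)
  rw [← exp_sum_prod] at h2
  simp only [Finset.sum_const, Finset.card_univ, Fintype.card_fin, nsmul_eq_mul,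
      ← exp_sum_prod] at h2
  have h3 := chernoff (gm d n) (fun V => ∑ i, - (ε * √d * |V i ⬝ᵥ g|)) (by fun_prop)
      (- (ε * √d * (n * s))) _ h2
  refine le_trans (measure_mono ?_) (h3.trans (ENNReal.ofReal_le_ofReal (Real.exp_le_exp.2 ?_)))
  · intro V hV
    simp only [Set.mem_ofPred_eq] at hV ⊢
    rw [Finset.sum_neg_distrib, ← Finset.mul_sum]
    exact neg_le_neg (mul_le_mul_of_nonneg_left hV (by positivity))
  · have := mul_le_mul_of_nonneg_left hs (show (0:ℝ) ≤ n * ε by positivity)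
    nlinarith

lemma part2_bound (d n : ℕ) (hd : 0 < d) (hn : 2 ≤ n) (hdn : d ≤ n) (ε τ κ : ℝ) (h0 : 0 < ε)
    (h1 : ε ≤ 1) (hτ : 0 ≤ τ) (hκ : (κ + 1 / n) * √d ≤ √(2 / Real.pi) - ε)
    (hc : (1 + ε) * √n ≤ τ * κ * n) :
    gaussianModel d n (PRset d n) ≤ ENNReal.ofReal
      (2 * Real.exp (- (d * ε ^ 2 / 8)) + (2 * (n * Real.exp (d * (3/8 - n/4)))
       + ((2 * (n:ℝ) ^ 3 + 1) ^ d * Real.exp (- (n *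
      ((√(2 * Real.pi))⁻¹ * Real.exp (- (((τ + 1 / n) * √d + 1) ^ 2 / 2)))))
       + (2 * (n:ℝ) ^ 3 + 1) ^ d * Real.exp (- (n * (ε ^ 2 / 2)))))) := by
  have hn0 : 0 < n := by omega
  set F : Set ((Fin n → Fin d → ℝ) × (Fin n → Fin d → ℝ)) :=
    {p | (1 + ε) ^ 2 * n ≤ frob p.1 p.2} with hF
  set T : Set (Fin n → Fin d → ℝ) := {x | ∃ i, (n:ℝ) ≤ x i ⬝ᵥ x i} with hT
  set B2 : Set (Fin n → Fin d → ℝ) := {U | ∃ b : Fin d → Fin (2 * (n ^ 3) + 1),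
    U ∈ {U : Fin n → Fin d → ℝ | 1 ≤ grid (n ^ 3) b ⬝ᵥ grid (n ^ 3) b ∧
      ∀ j, U j ⬝ᵥ grid (n ^ 3) b ≤ τ + 1 / n}} with hB2
  set B3 : Set (Fin n → Fin d → ℝ) := {V | ∃ b : Fin d → Fin (2 * (n ^ 3) + 1),
    V ∈ {V : Fin n → Fin d → ℝ | 1 ≤ grid (n ^ 3) b ⬝ᵥ grid (n ^ 3) b ∧
      ∑ i, |V i ⬝ᵥ grid (n ^ 3) b| ≤ n * (κ + 1 / n)}} with hB3
  have hsub : PRset d n ⊆ F ∪ (({p | p.1 ∈ T} ∪ {p | p.2 ∈ T}) ∪ ({p | p.1 ∈ B2} ∪ {p | p.2 ∈ B3})) := by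
    rintro ⟨U, V⟩ hp
    by_contra hcon
    simp only [Set.mem_union, not_or] at hcon
    obtain ⟨hf, ⟨hu, hv⟩, hb2, hb3⟩ := hcon
    have hu' : ∀ j, U j ⬝ᵥ U j ≤ n := fun j => by
      by_contra h
      exact hu ⟨j, (not_le.1 h).le⟩
    have hv' : ∀ j, V j ⬝ᵥ V j ≤ n := fun j => by
      by_contra h
      exact hv ⟨j, (not_le.1 h).le⟩
    have h2 : ∀ x : Fin d → ℝ, ∃ j, τ * √(x ⬝ᵥ x) ≤ U j ⬝ᵥ x := by
      intro x
      by_contra h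
      push Not at h
      exact hb2 (netE2 hn0 hdn τ U hu' x h)
    have h3 : ∀ a : Fin d → ℝ, κ * n * √(a ⬝ᵥ a) ≤ ∑ i, |a ⬝ᵥ V i| := by
      intro x
      by_contra h
      push Not at h
      exact hb3 (netE3 hn0 hdn κ V hv' x h)
    have h4 := det_bound hn U V τ κ hτ h2 h3 hp
    have h5 : √(frob U V) < (1 + ε) * √n := by
      have h6 : frob U V < (1 + ε) ^ 2 * n := not_le.1 hf
      have h7 : √(frob U V) < √((1 + ε) ^ 2 * n) := Real.sqrt_lt_sqrt
        (Finset.sum_nonneg fun _ _ => Finset.sum_nonneg fun _ _ => sq_nonneg _) h6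
      rwa [Real.sqrt_mul (by positivity), Real.sqrt_sq (by positivity)] at h7
    linarith
  have hcard : ((Fintype.card (Fin d → Fin (2 * (n ^ 3) + 1)) : ℕ) : ℝ) = (2 * (n:ℝ) ^ 3 + 1) ^ d := by
    simp
  have hs0 : 0 ≤ τ + 1 / n := by positivity
  have p2 : gm d n B2 ≤ ENNReal.ofReal ((2 * (n:ℝ) ^ 3 + 1) ^ d * Real.exp (- (n *
      ((√(2 * Real.pi))⁻¹ * Real.exp (- (((τ + 1 / n) * √d + 1) ^ 2 / 2)))))) := by
    rw [← hcard]
    refine union_fin (gm d n) _ _ fun b => ?_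
    by_cases hb : 1 ≤ grid (n ^ 3) b ⬝ᵥ grid (n ^ 3) b
    · simp only [hb, true_and]
      exact gm_le_prob d n hd _ hb _ hs0
    · simp [hb]
  have p3 : gm d n B3 ≤ ENNReal.ofReal ((2 * (n:ℝ) ^ 3 + 1) ^ d *
      Real.exp (- (n * (ε ^ 2 / 2)))) := by
    rw [← hcard]
    refine union_fin (gm d n) _ _ fun b => ?_
    by_cases hb : 1 ≤ grid (n ^ 3) b ⬝ᵥ grid (n ^ 3) b
    · simp only [hb, true_and]
      exact gm_abs_prob d n hd _ hb ε h0.le _ hκ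
    · simp [hb]
  have pT := gm_norm_big d n hd n
  have pF := frob_prob d n hd hn0 ε h0 h1
  refine (measure_mono hsub).trans ((measure_union_le _ _).trans ?_)
  rw [ENNReal.ofReal_add (by positivity) (by positivity)]
  refine add_le_add pF ((measure_union_le _ _).trans ?_)
  rw [ENNReal.ofReal_add (by positivity) (by positivity)]
  refine add_le_add ((measure_union_le _ _).trans ?_) ((measure_union_le _ _).trans ?_)
  · rw [gmodel_fst, gmodel_snd, two_mul, ENNReal.ofReal_add (by positivity) (by positivity)]
    exact add_le_add pT pT
  · rw [gmodel_fst, gmodel_snd, ENNReal.ofReal_add (by positivity) (by positivity)]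
    exact add_le_add p2 p3

set_option maxHeartbeats 1000000 in
lemma part2_fix (ρ ε : ℝ) (hρ : 0 < ρ) (hρ1 : ρ ≤ 1) (h0 : 0 < ε) (h1 : ε ≤ 1/2)
    (hε : √ρ * (1 + ε) ≤ (1 - ε) * (√(2 / Real.pi) - 2 * ε)) (d n : ℕ) (hd : 0 < d) (L : ℝ)
    (hL : L = Real.log n) (hL2 : 2 ≤ L) (hdn : (d:ℝ) ^ 2 ≤ ρ * n * L)
    (c1 : 4 ≤ ε * √L) (c2 : 4 * L ^ 2 + 1 ≤ (√(2 * Real.pi))⁻¹ * Real.exp (ε * L / 4))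
    (c3 : 4 * L ^ 2 + 1 ≤ Real.exp (L / 2) * (ε ^ 2 / 2))
    (c4 : 2 * L + 3 / 8 ≤ Real.exp L / 4) (c5 : Real.exp (- (L / 2)) ≤ ε) :
    gaussianModel d n (PRset d n) ≤ ENNReal.ofReal
      (2 * Real.exp (- (d * ε ^ 2 / 8)) + 4 * Real.exp (-L)) := by
  have hd' : (1:ℝ) ≤ d := by exact_mod_cast hd
  have hd0 : (0:ℝ) < d := by linarith
  have hnpos : 0 < n := by
    rcases Nat.eq_zero_or_pos n with h | h
    · rw [h] at hL; simp at hL; linarith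
    · exact h
  have hn0 : (0:ℝ) < n := by exact_mod_cast hnpos
  have hnL : (n:ℝ) = Real.exp L := by rw [hL, Real.exp_log hn0]
  have hn3' : (3:ℝ) ≤ n := by
    rw [hnL]; have := Real.add_one_le_exp L; linarith
  have hn3 : 3 ≤ n := by exact_mod_cast hn3'
  have hLn : L ≤ n := by rw [hnL]; have := Real.add_one_le_exp L; linarith
  have hd2 : (d:ℝ) ^ 2 ≤ n * L := by
    refine hdn.trans ?_
    have : 0 ≤ n * L := by positivity
    nlinarith
  have hdnR : (d:ℝ) ≤ n := by
    refine le_of_sq_le_sq ?_ hn0.le |> id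
    nlinarith
  have hdnN : d ≤ n := by exact_mod_cast hdnR
  have hL0 : 0 < L := by linarith
  set sL := √L with hsL
  have hsL0 : 0 < sL := Real.sqrt_pos.2 hL0
  have hsLL : sL * sL = L := Real.mul_self_sqrt hL0.le
  set sd := √(d:ℝ) with hsd
  have hsd0 : 0 < sd := Real.sqrt_pos.2 hd0
  have hsdd : sd * sd = d := Real.mul_self_sqrt hd0.le
  set sn := √(n:ℝ) with hsn
  have hsn0 : 0 < sn := Real.sqrt_pos.2 hn0
  have hsnn : sn * sn = n := Real.mul_self_sqrt hn0.le
  have hsne : sn = Real.exp (L / 2) := by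
    rw [hsn, hnL, Real.sqrt_eq_iff_mul_self_eq (Real.exp_pos _).le (Real.exp_pos _).le,
      ← Real.exp_add]; congr 1; ring
  have hsdn : sd ≤ sn := Real.sqrt_le_sqrt hdnR
  have hsd_n : 1 / n * sd ≤ Real.exp (- (L / 2)) := by
    rw [Real.exp_neg, ← hsne, ← hsnn]
    rw [one_div_mul_eq_div, div_le_iff₀ (by positivity)]
    field_simp; exact hsdn
  have hsdle : sd / n ≤ 1 := by
    rw [div_le_one hn0]; nlinarith only [hsdn, hsd0, hsdd, hd', hdnR]
  -- parameters
  set τ := (1 - ε) * sL / sd with hτ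
  set κ := (√(2 / Real.pi) - 2 * ε) / sd with hκ
  have hτ0 : 0 ≤ τ := div_nonneg (mul_nonneg (by linarith) hsL0.le) hsd0.le
  have hκ' : (κ + 1 / n) * sd ≤ √(2 / Real.pi) - ε := by
    have : κ * sd = √(2 / Real.pi) - 2 * ε := by rw [hκ]; field_simp
    rw [add_mul, this]; linarith
  have hdle : (d:ℝ) ≤ √ρ * (sn * sL) := by
    have : √((d:ℝ) ^ 2) ≤ √(ρ * (n * L)) := Real.sqrt_le_sqrt (by linarith)
    rwa [Real.sqrt_sq hd0.le, Real.sqrt_mul hρ.le, Real.sqrt_mul hn0.le] at this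
  have hc : (1 + ε) * sn ≤ τ * κ * n := by
    have e : τ * κ * n = ((1 - ε) * (√(2 / Real.pi) - 2 * ε) * (sn * sL)) * sn / d := by
      rw [hτ, hκ, ← hsdd, ← hsnn]; field_simp
    rw [e, le_div_iff₀ hd0]
    have h2 : (1 + ε) * d ≤ (1 - ε) * (√(2 / Real.pi) - 2 * ε) * (sn * sL) := by
      calc (1 + ε) * d ≤ (1 + ε) * (√ρ * (sn * sL)) := by gcongr
        _ = (√ρ * (1 + ε)) * (sn * sL) := by ring
        _ ≤ _ := by gcongr
    have h3 := mul_le_mul_of_nonneg_right h2 hsn0.le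
    linarith
  refine (part2_bound d n hd (by omega) hdnN ε τ κ h0 (by linarith) hτ0 hκ' hc).trans
    (ENNReal.ofReal_le_ofReal ?_)
  have hpow : (2 * (n:ℝ) ^ 3 + 1) ^ d ≤ Real.exp (sn * (4 * L ^ 2)) := by
    have h1 : 2 * (n:ℝ) ^ 3 + 1 ≤ Real.exp (4 * L) := by
      have : Real.exp (4 * L) = n ^ 4 := by
        rw [hnL, ← Real.exp_nat_mul]; norm_num
      rw [this]
      have h3 : 0 < (n:ℝ) ^ 3 := by positivity
      have h4 : 1 ≤ (n:ℝ) ^ 3 := one_le_pow₀ (by linarith)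
      nlinarith
    calc _ ≤ (Real.exp (4 * L)) ^ d := by gcongr
      _ = Real.exp (d * (4 * L)) := by rw [Real.exp_nat_mul]
      _ ≤ _ := by
        rw [Real.exp_le_exp]
        have h5 : (d:ℝ) ≤ sn * L := by
          refine hdle.trans ?_
          have h6 : √ρ ≤ 1 := Real.sqrt_le_one.2 hρ1
          have h7 : sL ≤ L := by nlinarith
          calc √ρ * (sn * sL) ≤ 1 * (sn * L) := by gcongr
            _ = _ := one_mul _
        nlinarith
  have hLsn : L ≤ sn := by
    rw [hsne]
    have h8 : Real.exp (L/2) * (ε ^ 2 / 2) ≤ Real.exp (L/2) := by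
      refine mul_le_of_le_one_right (Real.exp_pos _).le ?_
      have : ε ^ 2 ≤ 1 := pow_le_one₀ h0.le (by linarith)
      linarith
    have h9 : L ≤ 4 * L ^ 2 := by nlinarith only [hL2]
    linarith
  have t1 : (n:ℝ) * Real.exp (d * (3/8 - n/4)) ≤ Real.exp (-L) := by
    conv_lhs => rw [hnL]
    rw [← Real.exp_add, Real.exp_le_exp]
    rw [← hnL] at c4 ⊢
    have h9 : (3:ℝ)/8 - n/4 ≤ - (2 * L) := by linarith
    have h10 := mul_le_mul_of_nonneg_left h9 hd0.le
    have h11 := mul_le_mul_of_nonneg_right hd' hL0.le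
    linarith
  have t3 : (2 * (n:ℝ) ^ 3 + 1) ^ d * Real.exp (- (n * (ε ^ 2 / 2))) ≤ Real.exp (-L) := by
    calc _ ≤ Real.exp (sn * (4 * L ^ 2)) * Real.exp (- (n * (ε ^ 2 / 2))) := by gcongr
      _ = Real.exp (sn * (4 * L ^ 2) + - (n * (ε ^ 2 / 2))) := by rw [Real.exp_add]
      _ ≤ _ := by
        rw [Real.exp_le_exp]
        rw [← hsne] at c3
        have h9 := mul_le_mul_of_nonneg_left c3 hsn0.le
        have h10 : sn * (sn * (ε ^ 2 / 2)) = n * (ε ^ 2 / 2) := by rw [← hsnn]; ring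
        linarith
  have t2 : (2 * (n:ℝ) ^ 3 + 1) ^ d * Real.exp (- (n *
      ((√(2 * Real.pi))⁻¹ * Real.exp (- (((τ + 1 / n) * sd + 1) ^ 2 / 2))))) ≤ Real.exp (-L) := by
    have hs : (τ + 1 / n) * sd + 1 ≤ (1 - ε / 2) * sL := by
      have : τ * sd = (1 - ε) * sL := by rw [hτ]; field_simp
      rw [add_mul, this]
      have : 1 / n * sd ≤ 1 := by rw [one_div_mul_eq_div]; exact hsdle
      linarith
    have hs0 : 0 ≤ (τ + 1 / n) * sd + 1 := by positivity
    have hsq : ((τ + 1 / n) * sd + 1) ^ 2 / 2 ≤ L / 2 - ε * L / 4 := by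
      have h9 := pow_le_pow_left₀ hs0 hs 2
      have : ((1 - ε / 2) * sL) ^ 2 = (1 - ε / 2) ^ 2 * L := by rw [← hsLL]; ring
      rw [this] at h9
      have h10 : (1 - ε / 2) ^ 2 ≤ 1 - ε / 2 := by nlinarith only [h0, h1]
      have h11 := mul_le_mul_of_nonneg_right h10 hL0.le
      linarith
    have hq : sn * Real.exp (ε * L / 4) ≤ n * Real.exp (- (((τ + 1 / n) * sd + 1) ^ 2 / 2)) := by
      rw [hsne, hnL, ← Real.exp_add, ← Real.exp_add, Real.exp_le_exp]
      rw [← hnL]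
      linarith
    calc _ ≤ Real.exp (sn * (4 * L ^ 2)) * Real.exp (- (n *
      ((√(2 * Real.pi))⁻¹ * Real.exp (- (((τ + 1 / n) * sd + 1) ^ 2 / 2))))) := by gcongr
      _ = Real.exp (sn * (4 * L ^ 2) + - (n *
      ((√(2 * Real.pi))⁻¹ * Real.exp (- (((τ + 1 / n) * sd + 1) ^ 2 / 2))))) := by rw [Real.exp_add]
      _ ≤ _ := by
        rw [Real.exp_le_exp]
        have h10 := mul_le_mul_of_nonneg_left c2 hsn0.le
        have h11 := mul_le_mul_of_nonneg_left hq (show 0 ≤ (√(2 * Real.pi))⁻¹ by positivity)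
        linarith
  linarith

lemma exists_eps (ρ : ℝ) (hρ0 : 0 < ρ) (hρ : ρ < 2 / Real.pi) : ∃ ε : ℝ, 0 < ε ∧ ε ≤ 1/2 ∧
    √ρ * (1 + ε) ≤ (1 - ε) * (√(2 / Real.pi) - 2 * ε) := by
  have h := Real.sqrt_lt_sqrt hρ0.le hρ
  have ht : Tendsto (fun ε : ℝ => (1 - ε) * (√(2 / Real.pi) - 2 * ε) - √ρ * (1 + ε)) (𝓝[>] 0)
      (𝓝 ((1 - 0) * (√(2 / Real.pi) - 2 * 0) - √ρ * (1 + 0))) := by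
    refine (Continuous.tendsto (by fun_prop) 0).mono_left nhdsWithin_le_nhds
  have h1 := ht.eventually (lt_mem_nhds (a := 0) (by linarith))
  have h2 : ∀ᶠ ε : ℝ in 𝓝[>] 0, ε ∈ Set.Ioc (0:ℝ) (1/2) := Ioc_mem_nhdsGT (by norm_num)
  obtain ⟨ε, h3, h4⟩ := (h1.and h2).exists
  exact ⟨ε, h4.1, h4.2, by linarith⟩

lemma ev_exp (c b : ℝ) (hc : 0 < c) (hb : 0 < b) :
    ∀ᶠ L : ℝ in atTop, 4 * L ^ 2 + 1 ≤ b * Real.exp (c * L) := by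
  have h1 : Tendsto (fun L : ℝ => c * L) atTop atTop := tendsto_id.const_mul_atTop hc
  have h2 := (Real.tendsto_exp_div_pow_atTop 2).comp h1
  filter_upwards [h2.eventually_ge_atTop (5 / (b * c ^ 2)), eventually_ge_atTop 1] with L h3 h4
  simp only [Function.comp] at h3
  rw [div_le_div_iff₀ (by positivity) (by positivity)] at h3
  have h5 : 5 * L ^ 2 ≤ b * Real.exp (c * L) := by
    have : 0 < c ^ 2 := by positivity
    nlinarith
  nlinarith

theorem part2 (ρ₂ : ℝ) (hρ₂0 : 0 < ρ₂) (hρ₂ : ρ₂ < 2 / Real.pi)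
    (n d : ℕ → ℕ) (hn : Tendsto n atTop atTop) (hd : Tendsto d atTop atTop)
    (h : ∀ m, (d m : ℝ) ^ 2 ≤ ρ₂ * n m * Real.log (n m)) :
    Tendsto (fun m => gaussianModel (d m) (n m) (PRset (d m) (n m))) atTop
        (𝓝 (0 : ENNReal)) := by
  obtain ⟨ε, h0, h1, hε⟩ := exists_eps ρ₂ hρ₂0 hρ₂
  have hρ1 : ρ₂ ≤ 1 := hρ₂.le.trans (by rw [div_le_one Real.pi_pos]; exact Real.two_le_pi)
  have hL : Tendsto (fun m => Real.log (n m)) atTop atTop :=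
    Real.tendsto_log_atTop.comp (tendsto_natCast_atTop_atTop.comp hn)
  have hdR : Tendsto (fun m => (d m : ℝ)) atTop atTop := tendsto_natCast_atTop_atTop.comp hd
  have hlim : Tendsto (fun m => ENNReal.ofReal (2 * Real.exp (- (d m * ε ^ 2 / 8)) +
      4 * Real.exp (- Real.log (n m)))) atTop (𝓝 0) := by
    have a1 : Tendsto (fun m => Real.exp (- (d m * ε ^ 2 / 8))) atTop (𝓝 0) := by
      refine Real.tendsto_exp_neg_atTop_nhds_zero.comp ?_
      have : Tendsto (fun m => (d m : ℝ) * (ε ^ 2 / 8)) atTop atTop :=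
        hdR.atTop_mul_const (by positivity)
      refine this.congr fun m => by ring
    have a2 : Tendsto (fun m => Real.exp (- Real.log (n m))) atTop (𝓝 0) :=
      Real.tendsto_exp_neg_atTop_nhds_zero.comp hL
    have := ENNReal.tendsto_ofReal ((a1.const_mul 2).add (a2.const_mul 4))
    simpa using this
  refine tendsto_of_tendsto_of_tendsto_of_le_of_le' tendsto_const_nhds hlim
    (Eventually.of_forall fun _ => zero_le) ?_
  have e1 : ∀ᶠ L : ℝ in atTop, 4 ≤ ε * √L :=
    (Real.tendsto_sqrt_atTop.const_mul_atTop h0).eventually_ge_atTop 4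
  have e2 := ev_exp (ε / 4) (√(2 * Real.pi))⁻¹ (by positivity) (by positivity)
  have e3 := ev_exp (1 / 2) (ε ^ 2 / 2) (by positivity) (by positivity)
  have e4 := ev_exp 1 (1 / 4) (by positivity) (by positivity)
  have e5 : ∀ᶠ L : ℝ in atTop, Real.exp (- (L / 2)) ≤ ε := by
    have : Tendsto (fun L : ℝ => Real.exp (- (L / 2))) atTop (𝓝 0) :=
      Real.tendsto_exp_neg_atTop_nhds_zero.comp (tendsto_id.atTop_div_const (by norm_num))
    exact this.eventually (ge_mem_nhds h0)
  filter_upwards [hL.eventually e1, hL.eventually e2, hL.eventually e3, hL.eventually e4,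
    hL.eventually e5, hL.eventually_ge_atTop 2, hd.eventually_gt_atTop 0] with m f1 f2 f3 f4 f5 f6 f7
  refine part2_fix ρ₂ ε hρ₂0 hρ1 h0 h1 hε (d m) (n m) f7 _ rfl f6 (h m) f1 ?_ ?_ ?_ f5
  · rw [show ε * Real.log (n m) / 4 = ε / 4 * Real.log (n m) by ring]; exact f2
  · rw [mul_comm, show Real.log (n m) / 2 = 1 / 2 * Real.log (n m) by ring, mul_comm]
    rw [mul_comm (ε ^ 2 / 2)] at f3
    linarith
  · rw [one_mul] at f4
    nlinarith

/-- **Top-1 retrieval threshold.** One may take any `ρ₁ > 8` and any `ρ₂ < 2/π`: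
along any sequence `(n_m, d_m)` with `n_m, d_m → ∞`, if `d² ≥ ρ₁ n log n` throughout
then `P(PR_n) → 1`, and if `d² ≤ ρ₂ n log n` throughout then `P(PR_n) → 0`. -/
theorem top1_retrieval_threshold (ρ₁ ρ₂ : ℝ) (hρ₁ : 8 < ρ₁) (hρ₂0 : 0 < ρ₂)
    (hρ₂ : ρ₂ < 2 / Real.pi)
    (n d : ℕ → ℕ) (hn : Tendsto n atTop atTop) (hd : Tendsto d atTop atTop) :
    ((∀ m, ρ₁ * n m * Real.log (n m) ≤ (d m : ℝ) ^ 2) →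
      Tendsto (fun m => gaussianModel (d m) (n m) (PRset (d m) (n m))) atTop
        (𝓝 (1 : ENNReal))) ∧
    ((∀ m, (d m : ℝ) ^ 2 ≤ ρ₂ * n m * Real.log (n m)) →
      Tendsto (fun m => gaussianModel (d m) (n m) (PRset (d m) (n m))) atTop
        (𝓝 (0 : ENNReal))) := by
  exact ⟨part1 ρ₁ hρ₁ n d hn hd, part2 ρ₂ hρ₂0 hρ₂ n d hn hd⟩

end
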